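/- Let I = (f_1,…,f_n) be a generic ideal of type (n; d_1,…,d_n) in K[x_1,…,x_n] with d_1 ≤ ⋯ ≤ d_n. If d_i ≥ σ_{i−1} for every 4 ≤ i ≤ n (a vacuous condition when n ≤ 3), then the sequence x_n, x_{n−1}, …, x_1 is a semi-regular sequence on the graded algebra A = K[x_1,…,x_n]/I. -/

import Mathlib

open MvPolynomial

/-- The total degree of an exponent vector. -/
def expDeg {n : ℕ} (μ : Fin n →₀ ℕ) : ℕ := μ.sum fun _ e => e

/-- Strict degree reverse lexicographic order on exponent vectors, for variables
`x_1 > ⋯ > x_n` (indexed by `Fin n` in this order). -/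
def DrlLT {n : ℕ} (a b : Fin n →₀ ℕ) : Prop :=
  expDeg a < expDeg b ∨
    (expDeg a = expDeg b ∧ ∃ i : Fin n, b i < a i ∧ ∀ j : Fin n, i < j → a j = b j)

/-- `μ` is the leading (degrevlex-largest) exponent of `p`. -/
def IsLeadExp {n : ℕ} {K : Type*} [CommSemiring K] (p : MvPolynomial (Fin n) K)
    (μ : Fin n →₀ ℕ) : Prop :=
  μ ∈ p.support ∧ ∀ ν ∈ p.support, ν ≠ μ → DrlLT ν μ

/-- The initial ideal of `I` with respect to the degree reverse lexicographic order. -/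
noncomputable def initialIdeal {n : ℕ} {K : Type*} [CommRing K]
    (I : Ideal (MvPolynomial (Fin n) K)) : Ideal (MvPolynomial (Fin n) K) :=
  Ideal.span { m | ∃ p ∈ I, p ≠ 0 ∧ ∃ μ, IsLeadExp p μ ∧ m = monomial μ (1 : K) }

/-- The standard monomials of degree `i` of `I` : exponents of the monomials of degree `i`
not lying in the initial ideal of `I`. -/
def stdMon {n : ℕ} {K : Type*} [CommRing K] (I : Ideal (MvPolynomial (Fin n) K)) (i : ℕ) :
    Set (Fin n →₀ ℕ) :=
  { μ | expDeg μ = i ∧ monomial μ (1 : K) ∉ initialIdeal I }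

/-- `μ` is a minimal monomial generator of the monomial ideal `M`. -/
def IsMinGen {n : ℕ} {K : Type*} [CommRing K] (M : Ideal (MvPolynomial (Fin n) K))
    (μ : Fin n →₀ ℕ) : Prop :=
  monomial μ (1 : K) ∈ M ∧ ∀ ν : Fin n →₀ ℕ, ν ≤ μ → ν ≠ μ → monomial ν (1 : K) ∉ M

/-- `μ` satisfies property `P` with respect to the monomial ideal `M`: if `m` is the largest
index of a variable dividing `x^μ`, then every monomial of the same degree in the variables of
index `< m` also lies in `M`. -/
def SatisfiesP {n : ℕ} {K : Type*} [CommRing K] (M : Ideal (MvPolynomial (Fin n) K))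
    (μ : Fin n →₀ ℕ) : Prop :=
  ∀ m : Fin n, μ m ≠ 0 → (∀ j : Fin n, m < j → μ j = 0) →
    ∀ ν : Fin n →₀ ℕ, expDeg ν = expDeg μ → (∀ j : Fin n, m ≤ j → ν j = 0) →
      monomial ν (1 : K) ∈ M

/-- Conjecture E (Pardue) holds for the ideal `I`: every minimal generator of the initial
ideal of `I` satisfies property `P`. -/
def ConjE {n : ℕ} {K : Type*} [CommRing K] (I : Ideal (MvPolynomial (Fin n) K)) : Prop :=
  ∀ μ, IsMinGen (initialIdeal I) μ → SatisfiesP (initialIdeal I) μ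

/-- `f` is a generic sequence of forms of degrees `d i` over the base field `F`: each `f i` is
homogeneous of degree `d i` and the family of all coefficients (at all monomials of degree
`d i`) is algebraically independent over `F`. -/
def IsGenericSeq (F : Type*) {K : Type*} [CommRing F] [CommRing K] [Algebra F K]
    {n r : ℕ} (d : Fin r → ℕ) (f : Fin r → MvPolynomial (Fin n) K) : Prop :=
  (∀ i, (f i).IsHomogeneous (d i)) ∧
    AlgebraicIndependent F
      (fun p : Σ i : Fin r, { μ : Fin n →₀ ℕ // expDeg μ = d i } => (f p.1).coeff p.2.1)

/-- The projection `K[x_1,…,x_n,z] → K[x_1,…,x_n]` sending `z` (the last variable) to `0` and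
fixing the other variables. -/
noncomputable def projMap (K : Type*) [CommRing K] (n : ℕ) :
    MvPolynomial (Fin (n + 1)) K →ₐ[K] MvPolynomial (Fin n) K :=
  aeval (fun i => Fin.lastCases 0 (fun j => X j) i)

/-- Embedding of exponent vectors of `K[x_1,…,x_n]` into those of `K[x_1,…,x_n,z]`
(`z`-exponent `0`). -/
noncomputable def embExp {n : ℕ} (μ : Fin n →₀ ℕ) : Fin (n + 1) →₀ ℕ :=
  Finsupp.embDomain ⟨Fin.castSucc, Fin.castSucc_injective n⟩ μ

/-- Multiplication by `z^c` on exponent vectors in `K[x_1,…,x_n,z]`. -/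
noncomputable def zShift {n : ℕ} (c : ℕ) (μ : Fin (n + 1) →₀ ℕ) : Fin (n + 1) →₀ ℕ :=
  μ + Finsupp.single (Fin.last n) c

/-- `f` (homogeneous of degree `e`) is semi-regular on `R/I`: in each degree `t`, the
multiplication map `(R/I)_t → (R/I)_{t+e}` is injective or surjective. -/
def SemiRegularOn {vars K : Type*} [CommRing K] (I : Ideal (MvPolynomial vars K))
    (f : MvPolynomial vars K) (e : ℕ) : Prop :=
  ∀ t : ℕ,
    (∀ p ∈ homogeneousSubmodule vars K t, f * p ∈ I → p ∈ I) ∨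
    (∀ q ∈ homogeneousSubmodule vars K (t + e),
      ∃ p ∈ homogeneousSubmodule vars K t, q - f * p ∈ I)

/-- The degree-`t` graded piece of `R/I`, as a `K`-submodule of the quotient. -/
noncomputable def quotDegPart {vars K : Type*} [CommRing K] (I : Ideal (MvPolynomial vars K))
    (t : ℕ) : Submodule K (MvPolynomial vars K ⧸ I) :=
  (homogeneousSubmodule vars K t).map (Ideal.Quotient.mkₐ K I).toLinearMap

/-- The square Toeplitz matrices of size at most `B` built from the band sequence
`γ 0, …, γ D` act injectively on vectors with entries in any `K`-module. -/
def BandNonsingular {K : Type*} [Field K] (γ : ℕ → K) (D B : ℕ) : Prop :=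
  ∀ k ≤ D, ∀ r ≤ B, (Matrix.of fun a b : Fin r =>
    if (b : ℕ) ≤ k + a then γ (k + a - b) else 0).det ≠ 0

theorem exists_bandNonsingular (K : Type*) [Field K] [Infinite K] (D B : ℕ) (hB : 1 ≤ B) :
    ∃ γ : ℕ → K, γ D = 1 ∧ (∀ e, D < e → γ e = 0) ∧ BandNonsingular γ D B := by
  classical
  let Y : ℕ → MvPolynomial ℕ K := fun e => if e ≤ D then X e else 0
  let P : ℕ × ℕ → MvPolynomial ℕ K := fun q => (Matrix.of fun a b : Fin q.2 =>
    if (b : ℕ) ≤ q.1 + a then Y (q.1 + a - b) else 0).det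
  have hev : ∀ (x : ℕ → K) (q : ℕ × ℕ), eval x (P q) = (Matrix.of fun a b : Fin q.2 =>
      if (b : ℕ) ≤ q.1 + a then (if q.1 + a - b ≤ D then x (q.1 + a - b) else 0) else 0).det := by
    intro x q
    rw [RingHom.map_det]
    congr 1
    ext a b
    simp only [RingHom.mapMatrix_apply, Matrix.map_apply, Matrix.of_apply, Y]
    split_ifs <;> simp
  have hP : ∀ q : ℕ × ℕ, q.1 ≤ D → P q ≠ 0 := by
    intro q hq h0
    have h := hev (fun e => if e = q.1 then 1 else 0) q
    rw [h0, map_zero] at h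
    have h1 : (Matrix.of fun a b : Fin q.2 => if (b : ℕ) ≤ q.1 + a then
        (if q.1 + a - b ≤ D then (if q.1 + a - b = q.1 then (1 : K) else 0) else 0) else 0) = 1 := by
      ext a b
      simp only [Matrix.of_apply, Matrix.one_apply, Fin.ext_iff]
      split_ifs <;> first | rfl | omega
    rw [h1, Matrix.det_one] at h
    exact zero_ne_one h
  have hprod : (∏ q ∈ Finset.range (D + 1) ×ˢ Finset.range (B + 1), P q) ≠ 0 := by
    rw [Finset.prod_ne_zero_iff]
    intro q hq
    simp only [Finset.mem_product, Finset.mem_range] at hq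
    exact hP q (by omega)
  obtain ⟨x, hx⟩ : ∃ x : ℕ → K,
      eval x (∏ q ∈ Finset.range (D + 1) ×ˢ Finset.range (B + 1), P q) ≠ 0 := by
    by_contra! h
    exact hprod (MvPolynomial.funext fun x => by rw [h x, map_zero])
  rw [map_prod, Finset.prod_ne_zero_iff] at hx
  have hx' : ∀ k ≤ D, ∀ r ≤ B, eval x (P (k, r)) ≠ 0 := fun k hk r hr =>
    hx (k, r) (by simp only [Finset.mem_product, Finset.mem_range]; omega)
  have hD : x D ≠ 0 := by
    have := hx' D le_rfl 1 hB
    rw [hev] at this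
    simpa using this
  refine ⟨fun e => if e ≤ D then (x D)⁻¹ * x e else 0, by simp [hD], fun e he => ?_, ?_⟩
  · simp [not_le.mpr he]
  · intro k hk r hr
    have h := hx' k hk r hr
    rw [hev] at h
    have h2 : (Matrix.of fun a b : Fin r => if (b : ℕ) ≤ k + a then
        (if k + (a : ℕ) - b ≤ D then (x D)⁻¹ * x (k + a - b) else 0) else 0) =
        (x D)⁻¹ • (Matrix.of fun a b : Fin r => if (b : ℕ) ≤ k + a then
        (if k + (a : ℕ) - b ≤ D then x (k + a - b) else 0) else 0) := by
      ext a b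
      simp only [Matrix.of_apply, Matrix.smul_apply, smul_eq_mul]
      split_ifs <;> simp
    rw [h2, Matrix.det_smul]
    exact mul_ne_zero (pow_ne_zero _ (inv_ne_zero hD)) h

theorem BandNonsingular.eq_zero {K W : Type*} [Field K] [AddCommGroup W] [Module K W]
    {γ : ℕ → K} {D B : ℕ} (hγ : BandNonsingular γ D B) {k r : ℕ} (hk : k ≤ D) (hr : r ≤ B)
    (u : ℕ → W)
    (hu : ∀ a < r, ∑ b ∈ Finset.range r, (if b ≤ k + a then γ (k + a - b) else 0) • u b = 0) :
    ∀ b < r, u b = 0 := by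
  classical
  intro b hb
  set M := (Matrix.of fun a b : Fin r => if (b : ℕ) ≤ k + a then γ (k + a - b) else 0) with hM
  have hdet : IsUnit M.det := (hγ k hk r hr).isUnit
  have hmul : M⁻¹ * M = 1 := Matrix.nonsing_inv_mul M hdet
  have h1 : ∑ a : Fin r, M⁻¹ ⟨b, hb⟩ a • ∑ c : Fin r, M a c • u c = 0 := by
    refine Finset.sum_eq_zero fun a _ => ?_
    have := hu a a.2
    rw [Finset.sum_range] at this
    rw [hM]
    simp only [Matrix.of_apply]
    rw [this, smul_zero]
  simp only [Finset.smul_sum, smul_smul] at h1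
  rw [Finset.sum_comm] at h1
  simp only [← Finset.sum_smul, ← Matrix.mul_apply, hmul] at h1
  simpa [Matrix.one_apply] using h1

/-- Key vanishing: if multiplication by `x ^ (δ - 2 i)` is injective on the degree-`i` part of a
graded algebra for all `2 i ≤ δ`, then a homogeneous solution of a banded Toeplitz system in the
powers of `x` vanishes. -/
theorem toeplitz_system_eq_zero {K B : Type*} [Field K] [CommRing B] [Algebra K B]
    (G : ℕ → Submodule K B) (x : B) (δ D s t j N : ℕ) (γ : ℕ → K)
    (hst : s + 1 + t = δ) (hj : j + 2 * t = δ + D) (hN : δ + D + 1 ≤ N)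
    (hinj : ∀ i, 2 * i ≤ δ → ∀ b ∈ G i, x ^ (δ - 2 * i) * b = 0 → b = 0)
    (hγ : BandNonsingular γ (D + 1) N) (hγ0 : ∀ e, D + 1 < e → γ e = 0)
    (q : ℕ → B) (hq : ∀ l ≤ s, q l ∈ G (s - l)) (hq0 : ∀ l, s < l → q l = 0)
    (heq : ∀ l < j, ∑ i ∈ Finset.range (l + 1), γ (l - i) • (x ^ (D + 1 - (l - i)) * q i) = 0) :
    ∀ l < j, q l = 0 := by
  have key : ∀ p, 2 * p ≤ δ → ∀ l < j, l ≤ s → s - l ≤ δ - p →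
      x ^ (δ - p - (s - l)) * q l = 0 := by
    intro p
    induction p using Nat.strong_induction_on with
    | _ p ih =>
    intro hp l0 hl0 hl0s hl0p
    have hlow : ∀ l < j, s < l + p → q l = 0 := by
      intro l hl hlp
      by_cases hls : s < l
      · exact hq0 l hls
      have h1 := ih (s - l) (by omega) (by omega) l hl (by omega) (by omega)
      refine hinj (s - l) (by omega) _ (hq l (by omega)) ?_
      rw [← h1]
      congr 2
      omega
    -- window of unknowns and of equations
    set L0 := p - 1 - t with hL0
    set L1 := min (j - 1) (s - p) with hL1
    set E0 := D + p - t with hE0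
    by_cases hsp : s < l0 + p
    · rw [hlow l0 hl0 hsp, mul_zero]
    have hrec := hγ.eq_zero (W := B) (k := E0 - L0) (r := L1 + 1 - L0) (by omega) (by omega)
      (fun b => x ^ (L0 + b + t + 1 - p) * q (L0 + b)) ?_ (l0 - L0) (by omega)
    · have : L0 + (l0 - L0) = l0 := by omega
      simp only [this] at hrec
      rw [← hrec]
      congr 2
      omega
    intro a ha
    have hE := heq (E0 + a) (by omega)
    have hE2 : x ^ (E0 + a + t - p - D) * (∑ i ∈ Finset.range (E0 + a + 1),
        γ (E0 + a - i) • (x ^ (D + 1 - (E0 + a - i)) * q i)) = 0 := by rw [hE, mul_zero]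
    rw [Finset.mul_sum] at hE2
    set S := Finset.range (max (E0 + a + 1) (L1 + 1)) with hS
    let g : ℕ → B := fun i =>
      (if i ≤ E0 + a then γ (E0 + a - i) else 0) • (x ^ (i + t + 1 - p) * q i)
    have hA : ∑ i ∈ S, g i = 0 := by
      rw [← hE2]
      symm
      apply Finset.sum_subset_zero_on_sdiff
      · intro i hi
        simp only [hS, Finset.mem_range] at hi ⊢
        omega
      · intro i hi
        simp only [hS, Finset.mem_sdiff, Finset.mem_range] at hi
        simp only [g, if_neg (show ¬ i ≤ E0 + a by omega), zero_smul]
      · intro i hi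
        simp only [Finset.mem_range] at hi
        simp only [g, if_pos (show i ≤ E0 + a by omega)]
        by_cases h : D + 1 < E0 + a - i
        · rw [hγ0 _ h]; simp
        rw [mul_smul_comm, ← mul_assoc, ← pow_add]
        congr 3
        omega
    have hBsum : ∑ i ∈ Finset.Ico L0 (L1 + 1), g i = ∑ i ∈ S, g i := by
      apply Finset.sum_subset
      · intro i hi
        simp only [hS, Finset.mem_Ico, Finset.mem_range] at hi ⊢
        omega
      · intro i hi hi'
        simp only [hS, Finset.mem_Ico, Finset.mem_range] at hi hi'
        simp only [g]
        by_cases hi1 : i < L0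
        · split_ifs
          · rw [hγ0 _ (by omega), zero_smul]
          · rw [zero_smul]
        · split_ifs
          · rw [hlow i (by omega) (by omega), mul_zero, smul_zero]
          · rw [zero_smul]
    rw [hA, Finset.sum_Ico_eq_sum_range] at hBsum
    rw [← hBsum]
    refine Finset.sum_congr rfl fun b _ => ?_
    simp only [g]
    congr 1
    by_cases h : b ≤ E0 - L0 + a
    · rw [if_pos h, if_pos (by omega)]
      congr 1
      omega
    · rw [if_neg h, if_neg (by omega)]
  intro l hl
  by_cases hls : s < l
  · exact hq0 l hls
  by_cases h2 : 2 * (s - l) ≤ δ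
  · refine hinj (s - l) h2 _ (hq l (by omega)) ?_
    rw [← key (s - l) h2 l hl (by omega) (by omega)]
    congr 2
    omega
  · have := key (δ - (s - l)) (by omega) l hl (by omega) (by omega)
    rwa [show δ - (δ - (s - l)) - (s - l) = 0 by omega, pow_zero, one_mul] at this

/-- An ideal of a polynomial ring that contains the homogeneous components of its members. -/
def IsHomogIdeal {σ K : Type*} [CommRing K] (J : Ideal (MvPolynomial σ K)) : Prop :=
  ∀ p ∈ J, ∀ t, homogeneousComponent t p ∈ J

theorem isHomogIdeal_span {σ K : Type*} [CommRing K] {S : Set (MvPolynomial σ K)}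
    (hS : ∀ p ∈ S, ∃ e, p.IsHomogeneous e) : IsHomogIdeal (Ideal.span S) := by
  let := gradedAlgebra (σ := σ) (R := K)
  intro p hp t
  exact homogeneousComponent_mem_of_mem
    (Ideal.homogeneous_span _ S fun x hx => (hS x hx).imp fun _ h => h) hp t

theorem homogeneousComponent_mul_of_le {σ K : Type*} [CommRing K] {g : MvPolynomial σ K} {e : ℕ}
    (hg : g.IsHomogeneous e) (a : MvPolynomial σ K) (s : ℕ) :
    homogeneousComponent (s + e) (g * a) = g * homogeneousComponent s a := by
  classical
  conv_lhs => rw [← sum_homogeneousComponent a, Finset.mul_sum, map_sum]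
  have h : ∀ i, homogeneousComponent (s + e) (g * homogeneousComponent i a) =
      if i = s then g * homogeneousComponent s a else 0 := by
    intro i
    rw [homogeneousComponent_of_mem (hg.mul (homogeneousComponent_isHomogeneous i a))]
    by_cases his : i = s
    · subst his
      simp [add_comm]
    · rw [if_neg (by omega), if_neg his]
  rw [Finset.sum_congr rfl fun i _ => h i, Finset.sum_ite_eq']
  split_ifs with hs
  · rfl
  · rw [homogeneousComponent_eq_zero _ _ (by simpa using hs), mul_zero]

theorem homogeneousComponent_mul_of_lt {σ K : Type*} [CommRing K] {g : MvPolynomial σ K} {e : ℕ}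
    (hg : g.IsHomogeneous e) (a : MvPolynomial σ K) {t : ℕ} (ht : t < e) :
    homogeneousComponent t (g * a) = 0 := by
  rw [← sum_homogeneousComponent a, Finset.mul_sum, map_sum]
  refine Finset.sum_eq_zero fun i _ => ?_
  rw [homogeneousComponent_of_mem (hg.mul (homogeneousComponent_isHomogeneous i a)),
    if_neg (by omega)]

theorem IsHomogIdeal.mem_of_mem_sup_of_lt {σ K : Type*} [CommRing K]
    {J : Ideal (MvPolynomial σ K)} (hJ : IsHomogIdeal J) {g p : MvPolynomial σ K} {e t : ℕ}
    (hg : g.IsHomogeneous e) (hp : p.IsHomogeneous t) (hpJ : p ∈ J ⊔ Ideal.span {g})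
    (ht : t < e) : p ∈ J := by
  obtain ⟨j, hj, x, hx, rfl⟩ := Submodule.mem_sup.1 hpJ
  obtain ⟨a, rfl⟩ := Ideal.mem_span_singleton.1 hx
  have := hJ j hj t
  rwa [← homogeneousComponent_eq_self hp, map_add, homogeneousComponent_mul_of_lt hg a ht,
    add_zero]

theorem IsHomogIdeal.exists_sub_mul_mem {σ K : Type*} [CommRing K]
    {J : Ideal (MvPolynomial σ K)} (hJ : IsHomogIdeal J) {g p : MvPolynomial σ K} {e s : ℕ}
    (hg : g.IsHomogeneous e) (hp : p.IsHomogeneous (s + e)) (hpJ : p ∈ J ⊔ Ideal.span {g}) :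
    ∃ q : MvPolynomial σ K, q.IsHomogeneous s ∧ p - g * q ∈ J := by
  obtain ⟨j, hj, x, hx, rfl⟩ := Submodule.mem_sup.1 hpJ
  obtain ⟨a, rfl⟩ := Ideal.mem_span_singleton.1 hx
  refine ⟨homogeneousComponent s a, homogeneousComponent_isHomogeneous s a, ?_⟩
  have := hJ j hj (s + e)
  rwa [← homogeneousComponent_mul_of_le hg, ← homogeneousComponent_eq_self hp, map_add,
    add_sub_cancel_right]

/-- The degree-`t` piece of an ideal of a polynomial ring. -/
noncomputable def degPiece {σ K : Type*} [CommRing K] (J : Ideal (MvPolynomial σ K)) (t : ℕ) :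
    Submodule K (MvPolynomial σ K) :=
  J.restrictScalars K ⊓ homogeneousSubmodule σ K t

theorem degPiece_mono {σ K : Type*} [CommRing K] {J J' : Ideal (MvPolynomial σ K)} (h : J ≤ J')
    (t : ℕ) : degPiece J t ≤ degPiece J' t :=
  fun _ hp => ⟨h hp.1, hp.2⟩

theorem degPiece_le {σ K : Type*} [CommRing K] (J : Ideal (MvPolynomial σ K)) (t : ℕ) :
    degPiece J t ≤ homogeneousSubmodule σ K t := inf_le_right

theorem finite_homogeneousSubmodule (σ K : Type*) [Finite σ] [Field K] (t : ℕ) :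
    Module.Finite K (homogeneousSubmodule σ K t) :=
  Module.Finite.iff_fg.2 (homogeneousSubmodule_fg _ _ t)

theorem finite_degPiece {σ K : Type*} [Finite σ] [Field K] (J : Ideal (MvPolynomial σ K)) (t : ℕ) :
    Module.Finite K (degPiece J t) :=
  have := finite_homogeneousSubmodule σ K t
  Submodule.finiteDimensional_of_le (degPiece_le J t)

/-- The Hilbert function of an ideal. -/
noncomputable def hilbertFun {σ K : Type*} [Field K] (J : Ideal (MvPolynomial σ K)) (t : ℕ) : ℕ :=
  Module.finrank K (degPiece J t)

/-- The dimension of the degree-`t` part of the colon ideal `J : g`. -/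
noncomputable def colonFun {σ K : Type*} [Field K] (J : Ideal (MvPolynomial σ K))
    (g : MvPolynomial σ K) (t : ℕ) : ℕ :=
  Module.finrank K
    (((J.restrictScalars K).comap (LinearMap.mulLeft K g)) ⊓ homogeneousSubmodule σ K t :
      Submodule K (MvPolynomial σ K))

theorem hilbertFun_mono {σ K : Type*} [Finite σ] [Field K]
    {J J' : Ideal (MvPolynomial σ K)} (h : J ≤ J')
    (t : ℕ) : hilbertFun J t ≤ hilbertFun J' t :=
  have := finite_degPiece J' t
  Submodule.finrank_mono (degPiece_mono h t)

theorem hilbertFun_top_iff {σ K : Type*} [Finite σ] [Field K]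
    {J : Ideal (MvPolynomial σ K)} {t : ℕ} :
    hilbertFun J t = hilbertFun (⊤ : Ideal (MvPolynomial σ K)) t ↔
      ∀ p : MvPolynomial σ K, p.IsHomogeneous t → p ∈ J := by
  have := finite_degPiece (⊤ : Ideal (MvPolynomial σ K)) t
  constructor
  · intro h p hp
    have := Submodule.eq_of_le_of_finrank_le (degPiece_mono (le_top (a := J)) t) h.ge
    have h2 : p ∈ degPiece (⊤ : Ideal (MvPolynomial σ K)) t := ⟨trivial, hp⟩
    rw [← this] at h2
    exact h2.1
  · intro h
    refine congrArg (fun S : Submodule K (MvPolynomial σ K) => Module.finrank K S) ?_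
    exact le_antisymm (degPiece_mono le_top t) fun p hp => ⟨h p hp.2, hp.2⟩

theorem hilbertFun_le_colonFun {σ K : Type*} [Finite σ] [Field K] (J : Ideal (MvPolynomial σ K))
    (g : MvPolynomial σ K) (t : ℕ) : hilbertFun J t ≤ colonFun J g t := by
  have := finite_homogeneousSubmodule σ K t
  have : Module.Finite K (((J.restrictScalars K).comap (LinearMap.mulLeft K g)) ⊓
    homogeneousSubmodule σ K t : Submodule K (MvPolynomial σ K)) :=
    Submodule.finiteDimensional_of_le inf_le_right
  exact Submodule.finrank_mono fun p hp => ⟨J.mul_mem_left g hp.1, hp.2⟩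

theorem colonFun_eq_hilbertFun_iff {σ K : Type*} [Finite σ] [Field K] {J : Ideal (MvPolynomial σ K)}
    {g : MvPolynomial σ K} {t : ℕ} :
    colonFun J g t = hilbertFun J t ↔
      ∀ p : MvPolynomial σ K, p.IsHomogeneous t → g * p ∈ J → p ∈ J := by
  have := finite_homogeneousSubmodule σ K t
  have : Module.Finite K (((J.restrictScalars K).comap (LinearMap.mulLeft K g)) ⊓
    homogeneousSubmodule σ K t : Submodule K (MvPolynomial σ K)) :=
    Submodule.finiteDimensional_of_le inf_le_right
  have hle : degPiece J t ≤ (((J.restrictScalars K).comap (LinearMap.mulLeft K g)) ⊓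
    homogeneousSubmodule σ K t) := fun p hp => ⟨J.mul_mem_left g hp.1, hp.2⟩
  constructor
  · intro h p hp hpg
    have := Submodule.eq_of_le_of_finrank_le hle h.le
    have h2 : p ∈ (((J.restrictScalars K).comap (LinearMap.mulLeft K g)) ⊓
      homogeneousSubmodule σ K t) := ⟨hpg, hp⟩
    rw [← this] at h2
    exact h2.1
  · intro h
    refine congrArg (fun S : Submodule K (MvPolynomial σ K) => Module.finrank K S) ?_
    exact le_antisymm (fun p hp => ⟨h p hp.2 hp.1, hp.2⟩) hle

theorem IsHomogIdeal.hilbertFun_sup_of_lt {σ K : Type*} [Field K]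
    {J : Ideal (MvPolynomial σ K)} (hJ : IsHomogIdeal J) {g : MvPolynomial σ K} {e t : ℕ}
    (hg : g.IsHomogeneous e) (ht : t < e) :
    hilbertFun (J ⊔ Ideal.span {g}) t = hilbertFun J t := by
  refine congrArg (fun S : Submodule K (MvPolynomial σ K) => Module.finrank K S) ?_
  exact le_antisymm (fun p hp => ⟨hJ.mem_of_mem_sup_of_lt hg hp.2 hp.1 ht, hp.2⟩)
    (degPiece_mono le_sup_left t)

/-- Adding a form `g` to an ideal: the exact sequence of `J : g`, `J` and `J + (g)`. -/
theorem IsHomogIdeal.hilbertFun_sup_add {σ K : Type*} [Finite σ] [Field K]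
    {J : Ideal (MvPolynomial σ K)} (hJ : IsHomogIdeal J) {g : MvPolynomial σ K} {e : ℕ}
    (hg : g.IsHomogeneous e) (s : ℕ) :
    hilbertFun (J ⊔ Ideal.span {g}) (s + e) + colonFun J g s =
      hilbertFun J (s + e) + hilbertFun (⊤ : Ideal (MvPolynomial σ K)) s := by
  have := finite_homogeneousSubmodule σ K s
  have := finite_degPiece J (s + e)
  have := finite_degPiece (⊤ : Ideal (MvPolynomial σ K)) s
  let T : (degPiece J (s + e) × degPiece (⊤ : Ideal (MvPolynomial σ K)) s) →ₗ[K]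
      MvPolynomial σ K :=
    (degPiece J (s + e)).subtype.coprod ((LinearMap.mulLeft K g).comp (Submodule.subtype _))
  have hT : ∀ x, T x = (x.1 : MvPolynomial σ K) + g * x.2 := fun x => rfl
  have hrange : LinearMap.range T = degPiece (J ⊔ Ideal.span {g}) (s + e) := by
    ext p
    constructor
    · rintro ⟨⟨⟨a, ha⟩, ⟨b, hb⟩⟩, rfl⟩
      rw [hT]
      refine ⟨?_, ha.2.add ?_⟩
      · exact Ideal.add_mem _ (Ideal.mem_sup_left ha.1)
          (Ideal.mem_sup_right (Ideal.mul_mem_right _ _ (Ideal.subset_span rfl)))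
      · have := hg.mul hb.2
        rwa [add_comm e s] at this
    · rintro ⟨hp, hp'⟩
      obtain ⟨q, hq, hqJ⟩ := hJ.exists_sub_mul_mem hg hp' hp
      refine ⟨(⟨p - g * q, hqJ, ?_⟩, ⟨q, trivial, hq⟩), ?_⟩
      · refine hp'.sub ?_
        rw [add_comm s e]
        exact hg.mul hq
      · rw [hT]
        simp
  let S : Submodule K (MvPolynomial σ K) :=
    ((J.restrictScalars K).comap (LinearMap.mulLeft K g)) ⊓ homogeneousSubmodule σ K s
  have hker : Module.finrank K (LinearMap.ker T) = colonFun J g s := by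
    let φ : LinearMap.ker T →ₗ[K] MvPolynomial σ K :=
      (Submodule.subtype _).comp ((LinearMap.snd K _ _).comp (LinearMap.ker T).subtype)
    have hφ : ∀ x, φ x = (x.1.2 : MvPolynomial σ K) := fun x => rfl
    have hinj : Function.Injective φ := by
      rintro ⟨⟨a, b⟩, hab⟩ ⟨⟨a', b'⟩, hab'⟩ hb
      have hb : (b : MvPolynomial σ K) = b' := hb
      have h0 : (a : MvPolynomial σ K) + g * b = 0 := hab
      have h0' : (a' : MvPolynomial σ K) + g * b' = 0 := hab'
      rw [← h0', hb] at h0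
      exact Subtype.ext (Prod.ext (Subtype.ext (add_right_cancel h0)) (Subtype.ext hb))
    rw [← LinearMap.finrank_range_of_inj hinj]
    refine congrArg (fun S : Submodule K (MvPolynomial σ K) => Module.finrank K S) ?_
    ext p
    constructor
    · rintro ⟨⟨⟨⟨a, ha⟩, ⟨b, hb⟩⟩, hab⟩, rfl⟩
      rw [hφ]
      have h0 : a + g * b = 0 := hab
      refine ⟨?_, hb.2⟩
      change g * b ∈ J
      rw [eq_neg_of_add_eq_zero_right h0]
      exact J.neg_mem ha.1
    · rintro ⟨hp, hp'⟩
      have hgp : g * p ∈ J := hp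
      refine ⟨⟨(⟨-(g * p), J.neg_mem hgp, ?_⟩, ⟨p, trivial, hp'⟩), ?_⟩, rfl⟩
      · rw [add_comm s e]
        exact (hg.mul hp').neg
      · change -(g * p) + g * p = 0
        ring
  have key := LinearMap.finrank_range_add_finrank_ker T
  rw [hrange, hker, Module.finrank_prod] at key
  exact key

theorem degPiece_span_range {σ ι K : Type*} [CommRing K] {g : ι → MvPolynomial σ K} {e : ι → ℕ}
    (hg : ∀ i, (g i).IsHomogeneous (e i)) (t : ℕ) :
    degPiece (Ideal.span (Set.range g)) t = Submodule.span K
      {p | ∃ (ν : σ →₀ ℕ) (i : ι), ν.degree + e i = t ∧ p = monomial ν 1 * g i} := by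
  refine le_antisymm ?_ (Submodule.span_le.2 ?_)
  · rintro p ⟨hp, hpt⟩
    obtain ⟨c, rfl⟩ := Finsupp.mem_ideal_span_range_iff_exists_finsupp.1 hp
    rw [← homogeneousComponent_eq_self hpt, Finsupp.sum, map_sum]
    refine Submodule.sum_mem _ fun i _ => ?_
    rw [mul_comm]
    rcases lt_or_ge t (e i) with h | h
    · rw [homogeneousComponent_mul_of_lt (hg i) _ h]
      exact Submodule.zero_mem _
    · obtain ⟨s, rfl⟩ := Nat.exists_eq_add_of_le' h
      rw [homogeneousComponent_mul_of_le (hg i)]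
      have hq := homogeneousComponent_isHomogeneous s (c i)
      generalize homogeneousComponent s (c i) = q at hq
      rw [q.as_sum, Finset.mul_sum]
      refine Submodule.sum_mem _ fun ν hν => ?_
      have : g i * monomial ν (coeff ν q) = coeff ν q • (monomial ν 1 * g i) := by
        rw [mul_comm, ← smul_mul_assoc, smul_monomial, smul_eq_mul, mul_one]
      rw [this]
      refine Submodule.smul_mem _ _ (Submodule.subset_span ⟨ν, i, ?_, rfl⟩)
      have := hq.degree_eq_sum_deg_support hν
      rw [Finsupp.degree_apply, ← this]
  · rintro _ ⟨ν, i, h, rfl⟩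
    refine ⟨Ideal.mul_mem_left _ _ (Ideal.subset_span ⟨i, rfl⟩), ?_⟩
    have := (isHomogeneous_monomial (d := ν) (1 : K) rfl).mul (hg i)
    rwa [h] at this

theorem LinearIndependent.exists_det_coeff_ne_zero {σ K : Type*} [Field K] {k : ℕ}
    {v : Fin k → MvPolynomial σ K} (hv : LinearIndependent K v) :
    ∃ μ : Fin k → σ →₀ ℕ, (Matrix.of fun a b => coeff (μ b) (v a)).det ≠ 0 := by
  let S : Set (Fin k → K) := Set.range fun μ a => coeff μ (v a)
  have hS : Submodule.span K S = ⊤ := by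
    by_contra hne
    obtain ⟨l, hl, hle⟩ := Submodule.exists_le_ker_of_lt_top _ (lt_top_iff_ne_top.2 hne)
    apply hl
    have h0 : ∑ a, l (fun b => if a = b then 1 else 0) • v a = 0 := by
      ext μ
      have h1 : l (fun a => coeff μ (v a)) = 0 := hle (Submodule.subset_span ⟨μ, rfl⟩)
      rw [LinearMap.pi_apply_eq_sum_univ] at h1
      rw [coeff_sum, coeff_zero]
      refine Eq.trans ?_ h1
      exact Finset.sum_congr rfl fun a _ => by rw [coeff_smul, smul_eq_mul, smul_eq_mul, mul_comm]
    have := Fintype.linearIndependent_iff.1 hv _ h0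
    refine LinearMap.ext fun x => ?_
    rw [LinearMap.pi_apply_eq_sum_univ]
    simp [this]
  obtain ⟨w, hw, -, hwi⟩ := Submodule.exists_fun_fin_finrank_span_eq K S
  have hk : Module.finrank K (Submodule.span K S) = k := by
    rw [hS, finrank_top, Module.finrank_fin_fun]
  choose μ hμ using hw
  refine ⟨fun b => μ (Fin.cast hk.symm b), ?_⟩
  rw [← isUnit_iff_ne_zero, ← Matrix.isUnit_iff_isUnit_det,
    ← Matrix.linearIndependent_cols_iff_isUnit]
  have := hwi.comp (Fin.cast hk.symm) (Fin.cast_injective _)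
  have hw : (Matrix.of fun a b => coeff (μ (Fin.cast hk.symm b)) (v a)).col =
      w ∘ Fin.cast hk.symm := by
    ext b a
    exact congrFun (hμ (Fin.cast hk.symm b)) a
  rw [hw]
  exact this

theorem linearIndependent_map_of_injective {σ A K : Type*} [CommRing A] [Field K]
    {φ φ' : A →+* K} (hφ : Function.Injective φ) {k : ℕ} {V : Fin k → MvPolynomial σ A}
    (hV : LinearIndependent K fun a => map φ' (V a)) :
    LinearIndependent K fun a => map φ (V a) := by
  obtain ⟨μ, hμ⟩ := hV.exists_det_coeff_ne_zero
  have hdet : ∀ ψ : A →+* K, (Matrix.of fun a b => coeff (μ b) (map ψ (V a))).det =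
      ψ (Matrix.of fun a b => coeff (μ b) (V a)).det := by
    intro ψ
    rw [RingHom.map_det]
    congr 1
  have hne : (Matrix.of fun a b => coeff (μ b) (map φ (V a))).det ≠ 0 := by
    rw [hdet, Ne, map_eq_zero_iff φ hφ]
    intro h0
    rw [hdet, h0, map_zero] at hμ
    exact hμ rfl
  rw [← isUnit_iff_ne_zero, ← Matrix.isUnit_iff_isUnit_det,
    ← Matrix.linearIndependent_rows_iff_isUnit] at hne
  rw [Fintype.linearIndependent_iff] at hne ⊢
  intro c hc
  refine hne c ?_
  ext b
  have := congrArg (coeff (μ b)) hc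
  simpa [coeff_sum] using this

theorem finrank_span_le_of_forall_linearIndependent {K M : Type*} [Field K] [AddCommGroup M]
    [Module K M] {s : Set M} [Module.Finite K (Submodule.span K s)] {N : ℕ}
    (h : ∀ (k : ℕ) (v : Fin k → M), (∀ a, v a ∈ s) → LinearIndependent K v → k ≤ N) :
    Module.finrank K (Submodule.span K s) ≤ N := by
  obtain ⟨v, hv, -, hvi⟩ := Submodule.exists_fun_fin_finrank_span_eq K s
  exact h _ v hv hvi

/-- Semicontinuity of the Hilbert function under specialization of the coefficients. -/
theorem hilbertFun_specialize_le {σ ι A K : Type*} [Finite σ] [CommRing A] [Field K]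
    {φ φ' : A →+* K} (hφ : Function.Injective φ) (G : ι → MvPolynomial σ A) {e : ι → ℕ}
    (hG : ∀ i, (G i).IsHomogeneous (e i)) (t : ℕ) :
    hilbertFun (Ideal.span (Set.range fun i => map φ' (G i))) t ≤
      hilbertFun (Ideal.span (Set.range fun i => map φ (G i))) t := by
  have hspan := degPiece_span_range (fun i => (hG i).map φ') t
  have hfin := finite_degPiece (Ideal.span (Set.range fun i => map φ' (G i))) t
  have hfin' := finite_degPiece (Ideal.span (Set.range fun i => map φ (G i))) t
  rw [hspan] at hfin
  rw [hilbertFun, hspan]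
  refine finrank_span_le_of_forall_linearIndependent fun k v hv hvi => ?_
  choose ν i hdeg hv using hv
  have hV : ∀ (ψ : A →+* K) a,
      map ψ (monomial (ν a) 1 * G (i a)) = monomial (ν a) 1 * map ψ (G (i a)) := fun ψ a => by
    rw [map_mul, map_monomial, map_one]
  have hind : LinearIndependent K fun a => map φ (monomial (ν a) 1 * G (i a)) := by
    refine linearIndependent_map_of_injective (φ' := φ') hφ ?_
    simp_rw [hV, ← hv]
    exact hvi
  have hcard := finrank_span_eq_card hind
  rw [Fintype.card_fin] at hcard
  refine hcard.symm.le.trans (Submodule.finrank_mono (Submodule.span_le.2 ?_))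
  rintro _ ⟨a, rfl⟩
  rw [degPiece_span_range (fun i => (hG i).map φ) t]
  exact Submodule.subset_span ⟨ν a, i a, hdeg a, hV φ a⟩

/-- The ideal of `K[x_1,…,x_n]` generated by the first `r` members of `f` and by all variables
after the first `m`. -/
noncomputable def partialIdeal {n : ℕ} {K : Type*} [CommRing K]
    (f : Fin n → MvPolynomial (Fin n) K) (m r : ℕ) : Ideal (MvPolynomial (Fin n) K) :=
  Ideal.span (f '' {a | (a : ℕ) < r} ∪ X '' {j | m ≤ (j : ℕ)})

section partialIdeal

variable {n : ℕ} {K : Type*} [Field K] {f : Fin n → MvPolynomial (Fin n) K}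

theorem mem_partialIdeal_of_lt {m r : ℕ} {a : Fin n} (h : (a : ℕ) < r) : f a ∈ partialIdeal f m r :=
  Ideal.subset_span (Or.inl ⟨a, h, rfl⟩)

theorem X_mem_partialIdeal {m r : ℕ} {j : Fin n} (h : m ≤ (j : ℕ)) : X j ∈ partialIdeal f m r :=
  Ideal.subset_span (Or.inr ⟨j, h, rfl⟩)

theorem partialIdeal_mono {m m' r r' : ℕ} (hm : m' ≤ m) (hr : r ≤ r') :
    partialIdeal f m r ≤ partialIdeal f m' r' :=
  Ideal.span_mono (Set.union_subset_union (Set.image_mono fun _ h => lt_of_lt_of_le h hr)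
    (Set.image_mono fun _ h => le_trans hm h))

theorem partialIdeal_succ_right (m : ℕ) (r : Fin n) :
    partialIdeal f m (r + 1) = partialIdeal f m r ⊔ Ideal.span {f r} := by
  refine le_antisymm (Ideal.span_le.2 ?_) (sup_le (partialIdeal_mono le_rfl (Nat.le_succ _)) ?_)
  · rintro _ (⟨a, ha, rfl⟩ | ⟨j, hj, rfl⟩)
    · rcases Nat.lt_succ_iff_lt_or_eq.1 ha with h | h
      · exact Ideal.mem_sup_left (mem_partialIdeal_of_lt h)
      · obtain rfl := Fin.ext h
        exact Ideal.mem_sup_right (Ideal.subset_span rfl)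
    · exact Ideal.mem_sup_left (X_mem_partialIdeal hj)
  · rw [Ideal.span_le, Set.singleton_subset_iff]
    exact mem_partialIdeal_of_lt (Nat.lt_succ_self _)

theorem partialIdeal_succ_left (m : Fin n) (r : ℕ) :
    partialIdeal f m r = partialIdeal f (m + 1) r ⊔ Ideal.span {X m} := by
  refine le_antisymm (Ideal.span_le.2 ?_) (sup_le (partialIdeal_mono (Nat.le_succ _) le_rfl) ?_)
  · rintro _ (⟨a, ha, rfl⟩ | ⟨j, hj, rfl⟩)
    · exact Ideal.mem_sup_left (mem_partialIdeal_of_lt ha)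
    · rcases Nat.eq_or_lt_of_le hj with h | h
      · obtain rfl := Fin.ext h
        exact Ideal.mem_sup_right (Ideal.subset_span rfl)
      · exact Ideal.mem_sup_left (X_mem_partialIdeal h)
  · rw [Ideal.span_le, Set.singleton_subset_iff]
    exact X_mem_partialIdeal le_rfl

theorem isHomogIdeal_partialIdeal {d : Fin n → ℕ} (hf : ∀ i, (f i).IsHomogeneous (d i))
    (m r : ℕ) : IsHomogIdeal (partialIdeal f m r) := by
  refine isHomogIdeal_span ?_
  rintro _ (⟨a, -, rfl⟩ | ⟨j, -, rfl⟩)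
  · exact ⟨_, hf a⟩
  · exact ⟨_, isHomogeneous_X K j⟩

theorem IsGenericSeq.exists_specialization {F : Type*} [Field F] [Algebra F K] {d : Fin n → ℕ}
    (hf : IsGenericSeq F d f) {f' : Fin n → MvPolynomial (Fin n) K}
    (hf' : ∀ i, (f' i).IsHomogeneous (d i)) :
    ∃ (φ φ' : MvPolynomial (Σ i : Fin n, { μ : Fin n →₀ ℕ // expDeg μ = d i }) F →+* K)
      (G : Fin n → MvPolynomial (Fin n)
        (MvPolynomial (Σ i : Fin n, { μ : Fin n →₀ ℕ // expDeg μ = d i }) F)),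
      Function.Injective φ ∧ (∀ i, (G i).IsHomogeneous (d i)) ∧
        (∀ i, map φ (G i) = f i) ∧ ∀ i, map φ' (G i) = f' i := by
  classical
  let G : Fin n → MvPolynomial (Fin n)
      (MvPolynomial (Σ i : Fin n, { μ : Fin n →₀ ℕ // expDeg μ = d i }) F) := fun i =>
    ∑ μ ∈ (f i).support ∪ (f' i).support,
      monomial μ (if h : expDeg μ = d i then X ⟨i, ⟨μ, h⟩⟩ else 0)
  have hG : ∀ g : Fin n → MvPolynomial (Fin n) K, (∀ i, (g i).IsHomogeneous (d i)) →
      (∀ i, (g i).support ⊆ (f i).support ∪ (f' i).support) → ∀ i,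
      map (aeval (R := F) fun p : Σ i : Fin n, { μ : Fin n →₀ ℕ // expDeg μ = d i } =>
        (g p.1).coeff p.2.1).toRingHom (G i) = g i := by
    intro g hg hsup i
    conv_rhs => rw [(g i).as_sum]
    rw [map_sum]
    refine Eq.trans ?_ (Finset.sum_subset (hsup i) fun μ _ hμ => ?_).symm
    · refine Finset.sum_congr rfl fun μ _ => ?_
      rw [map_monomial]
      congr 1
      split_ifs with h
      · simp
      · rw [map_zero, (hg i).coeff_eq_zero h]
    · rw [notMem_support_iff.1 hμ, monomial_zero]
  refine ⟨_, _, G, hf.2, fun i => ?_, hG f hf.1 fun i => Finset.subset_union_left,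
    hG f' hf' fun i => Finset.subset_union_right⟩
  refine IsHomogeneous.sum _ _ _ fun μ _ => ?_
  split_ifs with h
  · exact isHomogeneous_monomial _ h
  · rw [monomial_zero]
    exact isHomogeneous_zero _ _ _

/-- Generic forms generate the largest possible ideals. -/
theorem IsGenericSeq.hilbertFun_le {F : Type*} [Field F] [Algebra F K] {d : Fin n → ℕ}
    (hf : IsGenericSeq F d f) {f' : Fin n → MvPolynomial (Fin n) K}
    (hf' : ∀ i, (f' i).IsHomogeneous (d i)) (m r t : ℕ) :
    hilbertFun (partialIdeal f' m r) t ≤ hilbertFun (partialIdeal f m r) t := by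
  obtain ⟨φ, φ', G, hφ, hG, hGf, hGf'⟩ := hf.exists_specialization hf'
  let H : {a : Fin n // (a : ℕ) < r} ⊕ {j : Fin n // m ≤ (j : ℕ)} → MvPolynomial (Fin n)
      (MvPolynomial (Σ i : Fin n, { μ : Fin n →₀ ℕ // expDeg μ = d i }) F) :=
    Sum.elim (fun a => G a) fun j => X j
  have hspan : ∀ (ψ : MvPolynomial (Σ i : Fin n, { μ : Fin n →₀ ℕ // expDeg μ = d i }) F →+* K)
      (g : Fin n → MvPolynomial (Fin n) K), (∀ i, map ψ (G i) = g i) →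
      Ideal.span (Set.range fun i => map ψ (H i)) = partialIdeal g m r := by
    intro ψ g hg
    refine congrArg Ideal.span (Set.ext fun p => ⟨?_, ?_⟩)
    · rintro ⟨a | j, rfl⟩
      · exact Or.inl ⟨a, a.2, (hg a).symm⟩
      · exact Or.inr ⟨j, j.2, (map_X ψ _).symm⟩
    · rintro (⟨a, ha, rfl⟩ | ⟨j, hj, rfl⟩)
      · exact ⟨Sum.inl ⟨a, ha⟩, hg a⟩
      · exact ⟨Sum.inr ⟨j, hj⟩, map_X ψ _⟩
  rw [← hspan φ f hGf, ← hspan φ' f' hGf']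
  refine hilbertFun_specialize_le hφ H (e := Sum.elim (fun a => d a) fun _ => 1) ?_ t
  rintro (a | j)
  · exact hG a
  · exact isHomogeneous_X _ _

end partialIdeal

/-- The homomorphism setting the variables of index at least `m` to `0`. -/
noncomputable def truncVars (n : ℕ) (K : Type*) [CommRing K] (m : ℕ) :
    MvPolynomial (Fin n) K →ₐ[K] MvPolynomial (Fin n) K :=
  aeval fun j => if (j : ℕ) < m then X j else 0

/-- The expansion of polynomials with respect to the variable `X m`, with coefficients in
`K[x_1,…,x_n]` modulo an ideal. -/
noncomputable def expandVar {n : ℕ} {K : Type*} [CommRing K] (m : Fin n)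
    (J : Ideal (MvPolynomial (Fin n) K)) :
    MvPolynomial (Fin n) K →ₐ[K] Polynomial (MvPolynomial (Fin n) K ⧸ J) :=
  aeval fun j => if j = m then Polynomial.X else Polynomial.C (Ideal.Quotient.mk J (X j))

section expandVar

variable {n : ℕ} {K : Type*} [Field K] {f : Fin n → MvPolynomial (Fin n) K} {m : Fin n}

theorem truncVars_X_of_lt {k : ℕ} {j : Fin n} (h : (j : ℕ) < k) :
    truncVars n K k (X j) = X j := by
  rw [truncVars, aeval_X, if_pos h]

theorem truncVars_X_of_le {k : ℕ} {j : Fin n} (h : k ≤ (j : ℕ)) :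
    truncVars n K k (X j) = 0 := by
  rw [truncVars, aeval_X, if_neg (not_lt.2 h)]

theorem expandVar_X_self (J : Ideal (MvPolynomial (Fin n) K)) :
    expandVar m J (X m) = Polynomial.X := by
  simp [expandVar]

theorem expandVar_X_of_ne (J : Ideal (MvPolynomial (Fin n) K)) {j : Fin n} (h : j ≠ m) :
    expandVar m J (X j) = Polynomial.C (Ideal.Quotient.mk J (X j)) := by
  simp [expandVar, h]

theorem mk_truncVars (p : MvPolynomial (Fin n) K) {k : ℕ} (r : ℕ) :
    Ideal.Quotient.mk (partialIdeal f k r) (truncVars n K k p) =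
      Ideal.Quotient.mk (partialIdeal f k r) p := by
  have : (Ideal.Quotient.mkₐ K (partialIdeal f k r)).comp (truncVars n K k) =
      Ideal.Quotient.mkₐ K (partialIdeal f k r) := by
    ext j
    by_cases hj : (j : ℕ) < k
    · simp [truncVars_X_of_lt hj]
    · simpa [truncVars_X_of_le (not_lt.1 hj)] using
        (Ideal.Quotient.eq_zero_iff_mem.2 (X_mem_partialIdeal (f := f) (r := r) (not_lt.1 hj))).symm
  exact DFunLike.congr_fun this p

theorem expandVar_truncVars (p : MvPolynomial (Fin n) K) (r : ℕ) :
    expandVar m (partialIdeal f m r) (truncVars n K m p) =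
      Polynomial.C (Ideal.Quotient.mk (partialIdeal f m r) p) := by
  rw [← mk_truncVars]
  have : (expandVar m (partialIdeal f m r)).comp (truncVars n K m) =
      ((Polynomial.CAlgHom (R := K)).comp (Ideal.Quotient.mkₐ K (partialIdeal f m r))).comp
        (truncVars n K m) := by
    ext1 j
    by_cases hj : (j : ℕ) < m
    · simp [truncVars_X_of_lt hj, expandVar_X_of_ne _ (Fin.ne_of_lt hj)]
    · simp [truncVars_X_of_le (not_lt.1 hj)]
  exact DFunLike.congr_fun this p

theorem expandVar_surjective (r : ℕ) :
    Function.Surjective (expandVar m (partialIdeal f m r)) := by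
  intro P
  induction P using Polynomial.induction_on' with
  | add p q hp hq =>
    obtain ⟨a, rfl⟩ := hp
    obtain ⟨b, rfl⟩ := hq
    exact ⟨a + b, map_add _ _ _⟩
  | monomial k b =>
    obtain ⟨b, rfl⟩ := Ideal.Quotient.mk_surjective b
    refine ⟨truncVars n K m b * X m ^ k, ?_⟩
    rw [map_mul, map_pow, expandVar_truncVars, expandVar_X_self, Polynomial.C_mul_X_pow_eq_monomial]

theorem expandVar_eq_zero_iff {r : ℕ} (hf : ∀ a : Fin n, (a : ℕ) < r → truncVars n K m (f a) = f a)
    {p : MvPolynomial (Fin n) K} :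
    expandVar m (partialIdeal f m r) p = 0 ↔ p ∈ partialIdeal f (m + 1) r := by
  constructor
  · intro hp
    have hlift : ∀ p ∈ partialIdeal f m r,
        ((Ideal.Quotient.mk (partialIdeal f (m + 1) r)).comp (truncVars n K m).toRingHom) p = 0 := by
      intro p hp
      refine (Ideal.span_le (I := RingHom.ker _)).2 ?_ hp
      rintro _ (⟨a, ha, rfl⟩ | ⟨j, hj, rfl⟩)
      · refine Ideal.Quotient.eq_zero_iff_mem.2 ?_
        change truncVars n K m (f a) ∈ _
        rw [hf a ha]
        exact mem_partialIdeal_of_lt ha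
      · change Ideal.Quotient.mk _ (truncVars n K m (X j)) = 0
        rw [truncVars_X_of_le hj, map_zero]
    let Ψ : Polynomial (MvPolynomial (Fin n) K ⧸ partialIdeal f m r) →+*
        MvPolynomial (Fin n) K ⧸ partialIdeal f (m + 1) r :=
      Polynomial.eval₂RingHom (Ideal.Quotient.lift _ _ hlift) (Ideal.Quotient.mk _ (X m))
    have hΨ : Ψ.comp (expandVar m (partialIdeal f m r)).toRingHom =
        Ideal.Quotient.mk (partialIdeal f (m + 1) r) := by
      refine MvPolynomial.ringHom_ext (fun c => ?_) fun j => ?_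
      · change Ψ (expandVar m (partialIdeal f m r) (C c)) = _
        rw [← MvPolynomial.algebraMap_eq, AlgHom.commutes, Polynomial.algebraMap_apply]
        change Polynomial.eval₂ _ _ (Polynomial.C (Ideal.Quotient.mk _ (C c))) = _
        rw [Polynomial.eval₂_C, Ideal.Quotient.lift_mk]
        change Ideal.Quotient.mk _ (truncVars n K m (C c)) = _
        rw [← MvPolynomial.algebraMap_eq, AlgHom.commutes]
      · change Ψ (expandVar m (partialIdeal f m r) (X j)) = _
        by_cases hj : j = m
        · subst hj
          rw [expandVar_X_self]
          exact Polynomial.eval₂_X _ _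
        · rw [expandVar_X_of_ne _ hj]
          change Polynomial.eval₂ _ _ (Polynomial.C _) = _
          rw [Polynomial.eval₂_C, Ideal.Quotient.lift_mk]
          change Ideal.Quotient.mk _ (truncVars n K m (X j)) = _
          by_cases hjm : (j : ℕ) < m
          · rw [truncVars_X_of_lt hjm]
          · have hlt : (m : ℕ) + 1 ≤ j := by
              have : (j : ℕ) ≠ m := fun h => hj (Fin.ext h)
              omega
            rw [truncVars_X_of_le (not_lt.1 hjm), map_zero,
              Ideal.Quotient.eq_zero_iff_mem.2 (X_mem_partialIdeal hlt)]
    rw [← Ideal.Quotient.eq_zero_iff_mem, ← hΨ]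
    change Ψ (expandVar m (partialIdeal f m r) p) = 0
    rw [hp, map_zero]
  · intro hp
    change p ∈ RingHom.ker (expandVar m (partialIdeal f m r)).toRingHom
    refine Ideal.span_le.2 ?_ hp
    rintro _ (⟨a, ha, rfl⟩ | ⟨j, hj, rfl⟩)
    · change expandVar m (partialIdeal f m r) (f a) = 0
      rw [← hf a ha, expandVar_truncVars,
        Ideal.Quotient.eq_zero_iff_mem.2 (mem_partialIdeal_of_lt ha), map_zero]
    · change expandVar m (partialIdeal f m r) (X j) = 0
      have hj : (m : ℕ) + 1 ≤ j := hj
      rw [expandVar_X_of_ne _ (by rintro rfl; omega),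
        Ideal.Quotient.eq_zero_iff_mem.2 (X_mem_partialIdeal (by omega)), map_zero]

theorem expandVar_monomial (J : Ideal (MvPolynomial (Fin n) K)) (μ : Fin n →₀ ℕ) (c : K) :
    expandVar m J (monomial μ c) =
      Polynomial.C (Ideal.Quotient.mk J (monomial (μ.erase m) c)) * Polynomial.X ^ μ m := by
  have h1 : monomial μ c = monomial (μ.erase m) c * X m ^ μ m := by
    rw [X_pow_eq_monomial, monomial_mul, mul_one, Finsupp.erase_add_single]
  have h2 : expandVar m J (monomial (μ.erase m) c) =
      Polynomial.C (Ideal.Quotient.mk J (monomial (μ.erase m) c)) := by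
    rw [monomial_eq, map_mul, ← MvPolynomial.algebraMap_eq, AlgHom.commutes, Finsupp.prod, map_prod,
      map_mul, map_mul, map_prod, map_prod]
    congr 1
    refine Finset.prod_congr rfl fun j hj => ?_
    have hjm : j ≠ m := by
      rintro rfl
      simp at hj
    rw [map_pow, map_pow, map_pow, expandVar_X_of_ne _ hjm]
  rw [h1, map_mul, map_pow, expandVar_X_self, h2]

theorem coeff_expandVar_of_lt (J : Ideal (MvPolynomial (Fin n) K)) {p : MvPolynomial (Fin n) K}
    {t l : ℕ} (hp : p.IsHomogeneous t) (h : t < l) : (expandVar m J p).coeff l = 0 := by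
  rw [p.as_sum, map_sum, Polynomial.finsetSum_coeff]
  refine Finset.sum_eq_zero fun μ hμ => ?_
  have hdeg := hp.degree_eq_sum_deg_support hμ
  have : μ m ≤ t := by
    rw [hdeg]
    exact Finsupp.le_degree m μ
  rw [expandVar_monomial, Polynomial.coeff_C_mul_X_pow, if_neg (by omega)]

theorem coeff_expandVar_mem (J : Ideal (MvPolynomial (Fin n) K)) {p : MvPolynomial (Fin n) K}
    {t : ℕ} (hp : p.IsHomogeneous t) (l : ℕ) :
    (expandVar m J p).coeff l ∈ quotDegPart J (t - l) := by
  rw [p.as_sum, map_sum, Polynomial.finsetSum_coeff]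
  refine Submodule.sum_mem _ fun μ hμ => ?_
  rw [expandVar_monomial, Polynomial.coeff_C_mul_X_pow]
  split_ifs with h
  · subst h
    refine ⟨_, isHomogeneous_monomial _ ?_, rfl⟩
    have hdeg := hp.degree_eq_sum_deg_support hμ
    have : (μ.erase m + Finsupp.single m (μ m)).degree = t := by
      rw [Finsupp.erase_add_single, hdeg, Finsupp.degree_apply]
    rw [map_add, Finsupp.degree_single] at this
    omega
  · exact Submodule.zero_mem _

end expandVar

/-- The codimension of an ideal in degree `t`. -/
noncomputable def codimFun {σ K : Type*} [Field K] (J : Ideal (MvPolynomial σ K)) (t : ℕ) : ℕ :=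
  hilbertFun (⊤ : Ideal (MvPolynomial σ K)) t - hilbertFun J t

theorem codimFun_add_hilbertFun {σ K : Type*} [Finite σ] [Field K]
    (J : Ideal (MvPolynomial σ K)) (t : ℕ) :
    codimFun J t + hilbertFun J t = hilbertFun (⊤ : Ideal (MvPolynomial σ K)) t :=
  Nat.sub_add_cancel (hilbertFun_mono le_top t)

theorem IsHomogIdeal.codimFun_sup_of_lt {σ K : Type*} [Field K]
    {J : Ideal (MvPolynomial σ K)} (hJ : IsHomogIdeal J) {g : MvPolynomial σ K} {e t : ℕ}
    (hg : g.IsHomogeneous e) (ht : t < e) :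
    codimFun (J ⊔ Ideal.span {g}) t = codimFun J t := by
  rw [codimFun, codimFun, hJ.hilbertFun_sup_of_lt hg ht]

theorem IsHomogIdeal.codimFun_sup_add_of_regular {σ K : Type*} [Finite σ] [Field K]
    {J : Ideal (MvPolynomial σ K)} (hJ : IsHomogIdeal J) {g : MvPolynomial σ K} {e : ℕ}
    (hg : g.IsHomogeneous e) (hreg : ∀ p, g * p ∈ J → p ∈ J) (s : ℕ) :
    codimFun (J ⊔ Ideal.span {g}) (s + e) + codimFun J s = codimFun J (s + e) := by
  have h1 := hJ.hilbertFun_sup_add hg s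
  have h2 := colonFun_eq_hilbertFun_iff.2 fun p (_ : p.IsHomogeneous s) => hreg p
  have h3 := codimFun_add_hilbertFun (J ⊔ Ideal.span {g}) (s + e)
  have h4 := codimFun_add_hilbertFun J (s + e)
  have h5 := codimFun_add_hilbertFun J s
  omega

/-- The convolution of a symmetric function with the indicator function of an interval is
symmetric. -/
theorem symm_of_eq_sum_window {h h' : ℕ → ℕ} {δ d : ℕ} (hd : 1 ≤ d)
    (hsymm : ∀ t ≤ δ, h t = h (δ - t)) (hzero : ∀ t, δ < t → h t = 0)
    (h'_eq : ∀ t, h' t = ∑ u ∈ Finset.range (t + 1), if t < u + d then h u else 0) :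
    (∀ t ≤ δ + (d - 1), h' t = h' (δ + (d - 1) - t)) ∧ ∀ t, δ + (d - 1) < t → h' t = 0 := by
  have key : ∀ t, h' t = ∑ u ∈ Finset.range (δ + 1), if u ≤ t ∧ t < u + d then h u else 0 := by
    intro t
    have h1 : h' t = ∑ u ∈ Finset.range (t + δ + 1), if u ≤ t ∧ t < u + d then h u else 0 := by
      rw [h'_eq]
      refine Finset.sum_subset_zero_on_sdiff (Finset.range_mono (by omega)) ?_ ?_
      · intro u hu
        rw [if_neg]
        simp only [Finset.mem_sdiff, Finset.mem_range] at hu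
        omega
      · intro u hu
        rw [Finset.mem_range] at hu
        simp only [show u ≤ t by omega, true_and]
    rw [h1]
    refine (Finset.sum_subset_zero_on_sdiff (Finset.range_mono (by omega)) ?_ fun _ _ => rfl).symm
    intro u hu
    simp only [Finset.mem_sdiff, Finset.mem_range] at hu
    rw [hzero u (by omega), ite_self]
  constructor
  · intro t ht
    rw [key, key, ← Finset.sum_range_reflect]
    refine Finset.sum_congr rfl fun u hu => ?_
    rw [Finset.mem_range] at hu
    rw [Nat.add_sub_cancel, ← hsymm u (by omega)]
    exact if_congr (by omega) rfl rfl
  · intro t ht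
    rw [key]
    refine Finset.sum_eq_zero fun u hu => ?_
    rw [Finset.mem_range] at hu
    rw [if_neg (by omega)]

/-- The last of the first `m` variables, and `0` if there is none. -/
noncomputable def lastVar (n : ℕ) (K : Type*) [CommRing K] (m : ℕ) : MvPolynomial (Fin n) K :=
  if h : 0 < m ∧ m ≤ n then X ⟨m - 1, by omega⟩ else 0

/-- The forms `∑ γ_e x_{a-1}^{d_a-e} x_a^e`, where `x_{-1} = 0`. -/
noncomputable def towerForm {n : ℕ} {K : Type*} [Field K] (d : Fin n → ℕ) (γ : Fin n → ℕ → K)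
    (a : Fin n) : MvPolynomial (Fin n) K :=
  ∑ e ∈ Finset.range (d a + 1), γ a e • (lastVar n K a ^ (d a - e) * X a ^ e)

section towerForm

variable {n : ℕ} {K : Type*} [Field K] {d : Fin n → ℕ} {γ : Fin n → ℕ → K}

theorem lastVar_succ (m : Fin n) : lastVar n K (m + 1) = X m := by
  rw [lastVar, dif_pos ⟨Nat.succ_pos _, m.2⟩]
  rfl

theorem isHomogeneous_lastVar (m : ℕ) : (lastVar n K m).IsHomogeneous 1 := by
  rw [lastVar]
  split_ifs
  · exact isHomogeneous_X _ _
  · exact isHomogeneous_zero _ _ _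

theorem isHomogeneous_towerForm (d : Fin n → ℕ) (γ : Fin n → ℕ → K) (a : Fin n) :
    (towerForm d γ a).IsHomogeneous (d a) := by
  refine IsHomogeneous.sum _ _ _ fun e he => ?_
  rw [Finset.mem_range] at he
  have h := ((isHomogeneous_lastVar (n := n) (K := K) a).pow (d a - e)).mul
    (isHomogeneous_X_pow (R := K) a e)
  rw [show 1 * (d a - e) + e = d a by omega] at h
  exact Submodule.smul_mem (homogeneousSubmodule (Fin n) K (d a)) _ h

theorem truncVars_towerForm {m : ℕ} {a : Fin n} (h : (a : ℕ) < m) :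
    truncVars n K m (towerForm d γ a) = towerForm d γ a := by
  have hl : truncVars n K m (lastVar n K a) = lastVar n K a := by
    rw [lastVar]
    split_ifs with h0
    · exact truncVars_X_of_lt (j := ⟨(a : ℕ) - 1, _⟩) (by simp only; omega)
    · exact map_zero _
  simp [towerForm, hl, truncVars_X_of_lt h]

theorem coeff_expandVar_towerForm (m : Fin n) (k : ℕ) (f : Fin n → MvPolynomial (Fin n) K) (e : ℕ) :
    (expandVar m (partialIdeal f m k) (towerForm d γ m)).coeff e =
      if e ≤ d m then
        γ m e • Ideal.Quotient.mk (partialIdeal f m k) (lastVar n K m) ^ (d m - e) else 0 := by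
  have hl : expandVar m (partialIdeal f m k) (lastVar n K m) =
      Polynomial.C (Ideal.Quotient.mk (partialIdeal f m k) (lastVar n K m)) := by
    rw [lastVar]
    split_ifs with h0
    · refine expandVar_X_of_ne _ fun h => ?_
      have := congrArg Fin.val h
      simp only at this
      omega
    · rw [map_zero, map_zero, map_zero]
  rw [towerForm, map_sum, Polynomial.finsetSum_coeff]
  have : ∀ i, (expandVar m (partialIdeal f m k)
      (γ m i • (lastVar n K m ^ (d m - i) * X m ^ i))).coeff e =
      if i = e then
        γ m e • Ideal.Quotient.mk (partialIdeal f m k) (lastVar n K m) ^ (d m - e) else 0 := by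
    intro i
    rw [map_smul, map_mul, map_pow, map_pow, hl, expandVar_X_self, Polynomial.coeff_smul,
      ← Polynomial.C_pow, Polynomial.coeff_C_mul_X_pow]
    by_cases h : e = i
    · subst h; simp
    · rw [if_neg h, if_neg (Ne.symm h), smul_zero]
  rw [Finset.sum_congr rfl fun i _ => this i, Finset.sum_ite_eq']
  simp only [Finset.mem_range, Nat.lt_succ_iff]

theorem monic_expandVar_towerForm {m : Fin n} (hγ : γ m (d m) = 1) (k : ℕ)
    (f : Fin n → MvPolynomial (Fin n) K) :
    (expandVar m (partialIdeal f m k) (towerForm d γ m)).Monic := by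
  refine Polynomial.monic_of_natDegree_le_of_coeff_eq_one (d m) ?_ ?_
  · rw [Polynomial.natDegree_le_iff_coeff_eq_zero]
    intro e he
    rw [coeff_expandVar_towerForm, if_neg (not_le.2 he)]
  · rw [coeff_expandVar_towerForm, if_pos le_rfl, hγ, Nat.sub_self, pow_zero, one_smul]

theorem mem_of_X_mul_mem_partialIdeal_towerForm {m : Fin n} {p : MvPolynomial (Fin n) K}
    (hp : X m * p ∈ partialIdeal (towerForm d γ) (m + 1) m) :
    p ∈ partialIdeal (towerForm d γ) (m + 1) m := by
  rw [← expandVar_eq_zero_iff fun a ha => truncVars_towerForm ha] at hp ⊢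
  rw [map_mul, expandVar_X_self] at hp
  exact Polynomial.monic_X.isRegular.left (by simpa using hp)

theorem mem_of_towerForm_mul_mem_partialIdeal_towerForm {m : Fin n} (hγ : γ m (d m) = 1)
    {p : MvPolynomial (Fin n) K}
    (hp : towerForm d γ m * p ∈ partialIdeal (towerForm d γ) (m + 1) m) :
    p ∈ partialIdeal (towerForm d γ) (m + 1) m := by
  rw [← expandVar_eq_zero_iff fun a ha => truncVars_towerForm ha] at hp ⊢
  rw [map_mul] at hp
  exact (monic_expandVar_towerForm hγ _ _).isRegular.left (by simpa using hp)

theorem codimFun_partialIdeal_towerForm_succ {m : Fin n} (hγ : γ m (d m) = 1) (t : ℕ) :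
    codimFun (partialIdeal (towerForm d γ) (m + 1) (m + 1)) t =
      ∑ u ∈ Finset.range (t + 1),
        if t < u + d m then codimFun (partialIdeal (towerForm d γ) m m) u else 0 := by
  have hJ := isHomogIdeal_partialIdeal (isHomogeneous_towerForm d γ) (m + 1) m
  have he : ∀ t, codimFun (partialIdeal (towerForm d γ) (m + 1) m) t =
      ∑ u ∈ Finset.range (t + 1), codimFun (partialIdeal (towerForm d γ) m m) u := by
    intro t
    rw [partialIdeal_succ_left m]
    induction t with
    | zero =>
      rw [Finset.sum_range_one, hJ.codimFun_sup_of_lt (isHomogeneous_X K m) Nat.zero_lt_one]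
    | succ t ih =>
      rw [Finset.sum_range_succ, ← ih, add_comm (codimFun _ t)]
      exact (hJ.codimFun_sup_add_of_regular (isHomogeneous_X K m)
        (fun p => mem_of_X_mul_mem_partialIdeal_towerForm) t).symm
  rw [partialIdeal_succ_right]
  rcases lt_or_ge t (d m) with h | h
  · rw [hJ.codimFun_sup_of_lt (isHomogeneous_towerForm d γ m) h, he]
    exact Finset.sum_congr rfl fun u _ => (if_pos (by omega)).symm
  · obtain ⟨s, rfl⟩ := Nat.exists_eq_add_of_le' h
    have h1 := hJ.codimFun_sup_add_of_regular (isHomogeneous_towerForm d γ m)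
      (fun p => mem_of_towerForm_mul_mem_partialIdeal_towerForm hγ) s
    rw [he, he] at h1
    have h2 : ∑ u ∈ Finset.range (s + 1), codimFun (partialIdeal (towerForm d γ) m m) u =
        ∑ u ∈ Finset.range (s + d m + 1),
          if s + d m < u + d m then 0 else codimFun (partialIdeal (towerForm d γ) m m) u := by
      refine Finset.sum_subset_zero_on_sdiff (Finset.range_mono (by omega)) ?_ ?_
      · intro u hu
        simp only [Finset.mem_sdiff, Finset.mem_range] at hu
        rw [if_pos (by omega)]
      · intro u hu
        rw [Finset.mem_range] at hu
        rw [if_neg (by omega)]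
    have h3 : ∑ u ∈ Finset.range (s + d m + 1), codimFun (partialIdeal (towerForm d γ) m m) u =
        (∑ u ∈ Finset.range (s + d m + 1),
          if s + d m < u + d m then codimFun (partialIdeal (towerForm d γ) m m) u else 0) +
        ∑ u ∈ Finset.range (s + d m + 1),
          if s + d m < u + d m then 0 else codimFun (partialIdeal (towerForm d γ) m m) u := by
      rw [← Finset.sum_add_distrib]
      exact Finset.sum_congr rfl fun u _ => by split_ifs <;> simp
    omega

/-- The socle degree of a complete intersection of the first `m` forms. -/
def socleDeg {n : ℕ} (d : Fin n → ℕ) (m : ℕ) : ℕ :=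
  ∑ a ∈ Finset.univ.filter (fun a : Fin n => (a : ℕ) < m), (d a - 1)

theorem socleDeg_zero (d : Fin n → ℕ) : socleDeg d 0 = 0 := by
  simp [socleDeg]

theorem socleDeg_succ (d : Fin n → ℕ) (m : Fin n) :
    socleDeg d (m + 1) = socleDeg d m + (d m - 1) := by
  have : Finset.univ.filter (fun a : Fin n => (a : ℕ) < m + 1) =
      insert m (Finset.univ.filter fun a : Fin n => (a : ℕ) < m) := by
    ext a
    simp only [Finset.mem_filter, Finset.mem_univ, true_and, Finset.mem_insert, Fin.ext_iff]
    omega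
  rw [socleDeg, this, Finset.sum_insert (by simp), add_comm]
  rfl

theorem codimFun_eq_zero_iff {σ : Type*} [Finite σ] {J : Ideal (MvPolynomial σ K)} {t : ℕ} :
    codimFun J t = 0 ↔ ∀ p : MvPolynomial σ K, p.IsHomogeneous t → p ∈ J := by
  rw [← hilbertFun_top_iff, ← codimFun_add_hilbertFun J t]
  omega

theorem mem_partialIdeal_zero {f : Fin n → MvPolynomial (Fin n) K} {r t : ℕ} (ht : 0 < t)
    {p : MvPolynomial (Fin n) K} (hp : p.IsHomogeneous t) : p ∈ partialIdeal f 0 r := by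
  rw [p.as_sum]
  refine Ideal.sum_mem _ fun μ hμ => ?_
  have hdeg := hp.degree_eq_sum_deg_support hμ
  obtain ⟨j, hj⟩ : ∃ j, μ j ≠ 0 := by
    by_contra! h
    rw [Finset.sum_eq_zero fun i _ => h i] at hdeg
    omega
  refine Ideal.mem_of_dvd _ ?_ (X_mem_partialIdeal (j := j) (Nat.zero_le _))
  rw [X_dvd_monomial]
  exact Or.inr hj

theorem codimFun_partialIdeal_towerForm_symm (hd : ∀ a, 1 ≤ d a) (hγ : ∀ a, γ a (d a) = 1) :
    ∀ m ≤ n, (∀ t ≤ socleDeg d m, codimFun (partialIdeal (towerForm d γ) m m) t =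
        codimFun (partialIdeal (towerForm d γ) m m) (socleDeg d m - t)) ∧
      ∀ t, socleDeg d m < t → codimFun (partialIdeal (towerForm d γ) m m) t = 0 := by
  intro m
  induction m with
  | zero =>
    intro _
    rw [socleDeg_zero]
    refine ⟨fun t ht => ?_, fun t ht => ?_⟩
    · rw [Nat.le_zero.1 ht]
    · exact codimFun_eq_zero_iff.2 fun p hp => mem_partialIdeal_zero ht hp
  | succ m ih =>
    intro hm
    obtain ⟨h1, h2⟩ := ih (Nat.le_of_succ_le hm)
    rw [socleDeg_succ d ⟨m, hm⟩]
    exact symm_of_eq_sum_window (hd ⟨m, hm⟩) h1 h2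
      (codimFun_partialIdeal_towerForm_succ (m := ⟨m, hm⟩) (hγ _))

theorem mem_of_X_pow_mul_mem_partialIdeal_towerForm {m : Fin n} {p : MvPolynomial (Fin n) K} (j : ℕ)
    (hp : X m ^ j * p ∈ partialIdeal (towerForm d γ) (m + 1) m) :
    p ∈ partialIdeal (towerForm d γ) (m + 1) m := by
  induction j with
  | zero => simpa using hp
  | succ j ih =>
    rw [pow_succ', mul_assoc] at hp
    exact ih (mem_of_X_mul_mem_partialIdeal_towerForm hp)

theorem sum_coeff_mul_coeff_eq_zero {B : Type*} [CommRing B] {P F Q : Polynomial B} {j l : ℕ}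
    (h : Polynomial.X ^ j * P = F * Q) (hl : l < j) :
    ∑ i ∈ Finset.range (l + 1), F.coeff (l - i) * Q.coeff i = 0 := by
  have hl0 : (Polynomial.X ^ j * P).coeff l = 0 := by
    rw [Polynomial.coeff_X_pow_mul', if_neg (not_le.2 hl)]
  rw [← hl0, h, mul_comm, Polynomial.coeff_mul, Finset.Nat.sum_antidiagonal_eq_sum_range_succ_mk]
  exact Finset.sum_congr rfl fun i _ => mul_comm _ _

theorem eq_mul_of_X_pow_mul_eq {B : Type*} [CommRing B] {P F Q : Polynomial B} {j : ℕ}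
    (h : Polynomial.X ^ j * P = F * (Polynomial.X ^ j * Q)) : P = F * Q := by
  rw [mul_left_comm] at h
  exact (Polynomial.monic_X_pow j).isRegular.left h

/-- The strong Lefschetz property (in its injective half) of the tower. -/
theorem mem_of_lastVar_pow_mul_mem (hd : ∀ a, 1 ≤ d a)
    (hγ0 : ∀ a e, d a < e → γ a e = 0)
    (hband : ∀ a : Fin n, BandNonsingular (γ a) (d a) (socleDeg d a + d a)) :
    ∀ m ≤ n, ∀ t, 2 * t ≤ socleDeg d m → ∀ p : MvPolynomial (Fin n) K, p.IsHomogeneous t →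
      lastVar n K m ^ (socleDeg d m - 2 * t) * p ∈ partialIdeal (towerForm d γ) m m →
      p ∈ partialIdeal (towerForm d γ) m m := by
  intro m
  induction m with
  | zero =>
    intro _ t _ p _ hp
    simpa [socleDeg_zero] using hp
  | succ k ih =>
    intro hm t ht p hp hmem
    obtain ⟨m, rfl⟩ : ∃ m : Fin n, (m : ℕ) = k := ⟨⟨k, hm⟩, rfl⟩
    replace ih := ih m.2.le
    rw [lastVar_succ, socleDeg_succ] at hmem
    rw [socleDeg_succ] at ht
    have hdm := hd m
    obtain ⟨D, hD⟩ : ∃ D, d m = D + 1 := ⟨d m - 1, by omega⟩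
    generalize hδ : socleDeg d m = δ at *
    generalize hj : δ + (d m - 1) - 2 * t = j at *
    have hJ := isHomogIdeal_partialIdeal (isHomogeneous_towerForm d γ) (m + 1) m
    have hXp : (X m ^ j * p : MvPolynomial (Fin n) K).IsHomogeneous (j + t) :=
      (isHomogeneous_X_pow m j).mul hp
    rw [partialIdeal_succ_right] at hmem ⊢
    rcases le_or_gt δ t with h | h
    · refine Ideal.mem_sup_left (mem_of_X_pow_mul_mem_partialIdeal_towerForm j ?_)
      exact hJ.mem_of_mem_sup_of_lt (isHomogeneous_towerForm d γ m) hXp hmem (by omega)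
    obtain ⟨s, hs⟩ : ∃ s, s + 1 + t = δ := ⟨δ - 1 - t, by omega⟩
    rw [show j + t = s + d m by omega] at hXp
    obtain ⟨q, hq, hqJ⟩ := hJ.exists_sub_mul_mem (isHomogeneous_towerForm d γ m) hXp hmem
    have hker : ∀ p, expandVar m (partialIdeal (towerForm d γ) m m) p = 0 ↔
        p ∈ partialIdeal (towerForm d γ) (m + 1) m := fun p =>
      expandVar_eq_zero_iff fun a ha => truncVars_towerForm ha
    have hcoeff := coeff_expandVar_towerForm (d := d) (γ := γ) m m (towerForm d γ)
    have hsurj := expandVar_surjective (f := towerForm d γ) (m := m) m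
    have hlt := fun l => coeff_expandVar_of_lt (m := m) (l := l)
      (partialIdeal (towerForm d γ) m m) hq
    have hle := coeff_expandVar_mem (m := m) (partialIdeal (towerForm d γ) m m) hq
    rw [← hker, map_sub, map_mul, map_mul, map_pow, expandVar_X_self, sub_eq_zero] at hqJ
    have hzero : ∀ l < j, (expandVar m (partialIdeal (towerForm d γ) m m) q).coeff l = 0 := by
      refine toeplitz_system_eq_zero (quotDegPart (partialIdeal (towerForm d γ) m m))
        (Ideal.Quotient.mk _ (lastVar n K m)) δ D s t j (δ + d m) (γ m) hs (by omega) (by omega)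
        ?_ (hD ▸ hδ ▸ hband m) (hD ▸ hγ0 m) _ (fun l _ => hle l) (fun l hl => hlt l hl) ?_
      · rintro i hi _ ⟨b, hb, rfl⟩ hxb
        refine Ideal.Quotient.eq_zero_iff_mem.2 (ih i hi b hb ?_)
        rw [← Ideal.Quotient.eq_zero_iff_mem, map_mul, map_pow]
        exact hxb
      · intro l hl
        rw [← sum_coeff_mul_coeff_eq_zero hqJ hl]
        refine Finset.sum_congr rfl fun i _ => ?_
        rw [hcoeff, hD]
        split_ifs with hi
        · exact (smul_mul_assoc _ _ _).symm
        · rw [hγ0 m _ (by omega), zero_smul, zero_mul]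
    obtain ⟨Q, hQ⟩ := (Polynomial.X_pow_dvd_iff (n := j)).2 hzero
    obtain ⟨q', rfl⟩ := hsurj Q
    rw [hQ] at hqJ
    have hp' := eq_mul_of_X_pow_mul_eq hqJ
    rw [← map_mul, ← sub_eq_zero, ← map_sub, hker] at hp'
    have := Ideal.add_mem _ (Ideal.mem_sup_left hp') (Ideal.mem_sup_right
      (Ideal.mul_mem_right q' _ (Ideal.subset_span (Set.mem_singleton (towerForm d γ m)))))
    rwa [sub_add_cancel] at this

end towerForm

section lefschetz

variable {n : ℕ} {K : Type*} [Field K] {d : Fin n → ℕ} {γ : Fin n → ℕ → K}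

theorem mem_of_X_mul_mem_partialIdeal_towerForm_succ (hd : ∀ a, 1 ≤ d a)
    (hγ0 : ∀ a e, d a < e → γ a e = 0)
    (hband : ∀ a : Fin n, BandNonsingular (γ a) (d a) (socleDeg d a + d a)) (m : Fin n) {t : ℕ}
    (ht : 2 * t < socleDeg d (m + 1)) {p : MvPolynomial (Fin n) K} (hp : p.IsHomogeneous t)
    (hmem : X m * p ∈ partialIdeal (towerForm d γ) (m + 1) (m + 1)) :
    p ∈ partialIdeal (towerForm d γ) (m + 1) (m + 1) := by
  refine mem_of_lastVar_pow_mul_mem hd hγ0 hband (m + 1) m.2 t ht.le p hp ?_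
  obtain ⟨j, hj⟩ : ∃ j, socleDeg d (m + 1) - 2 * t = j + 1 := ⟨_, (Nat.succ_pred (by omega)).symm⟩
  rw [lastVar_succ, hj, pow_succ, mul_assoc]
  exact Ideal.mul_mem_left _ _ hmem

theorem mem_partialIdeal_towerForm (hd : ∀ a, 1 ≤ d a) (hγ : ∀ a, γ a (d a) = 1)
    (hγ0 : ∀ a e, d a < e → γ a e = 0)
    (hband : ∀ a : Fin n, BandNonsingular (γ a) (d a) (socleDeg d a + d a)) (m : Fin n) {t : ℕ}
    (ht : socleDeg d (m + 1) ≤ 2 * t + 1) {p : MvPolynomial (Fin n) K}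
    (hp : p.IsHomogeneous (t + 1)) : p ∈ partialIdeal (towerForm d γ) m (m + 1) := by
  obtain ⟨hsymm, hzero⟩ := codimFun_partialIdeal_towerForm_symm hd hγ (m + 1) m.2
  have hJ := isHomogIdeal_partialIdeal (isHomogeneous_towerForm d γ) (m + 1) (m + 1)
  rw [partialIdeal_succ_left m]
  rcases lt_or_ge (socleDeg d (m + 1)) (t + 1) with h | h
  · exact Ideal.mem_sup_left (codimFun_eq_zero_iff.1 (hzero _ h) p hp)
  obtain ⟨u, hu⟩ := Nat.exists_eq_add_of_le' h
  obtain ⟨j, hj⟩ : ∃ j, t + 1 = u + (j + 1) := ⟨t - u, by omega⟩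
  have hX := isHomogeneous_X_pow (R := K) m (j + 1)
  have hreg := colonFun_eq_hilbertFun_iff.2
    (mem_of_lastVar_pow_mul_mem hd hγ0 hband (m + 1) m.2 u (by omega))
  rw [lastVar_succ, show socleDeg d (m + 1) - 2 * u = j + 1 by omega] at hreg
  have hs := hJ.hilbertFun_sup_add hX u
  have h0 := hsymm (t + 1) h
  rw [show socleDeg d (m + 1) - (t + 1) = u by omega] at h0
  have h1 := codimFun_add_hilbertFun (partialIdeal (towerForm d γ) (m + 1) (m + 1)) (t + 1)
  have h2 := codimFun_add_hilbertFun (partialIdeal (towerForm d γ) (m + 1) (m + 1)) u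
  rw [← hj] at hs
  refine (sup_le_sup_left ?_ _ : _ ⊔ Ideal.span {X m ^ (j + 1)} ≤ _)
    (hilbertFun_top_iff.1 (by omega) p hp)
  rw [Ideal.span_singleton_le_span_singleton]
  exact dvd_pow_self _ (Nat.succ_ne_zero j)

theorem partialIdeal_zero_right (f f' : Fin n → MvPolynomial (Fin n) K) (m : ℕ) :
    partialIdeal f m 0 = partialIdeal f' m 0 := by
  simp [partialIdeal]

theorem mem_of_X_pow_mul_mem_partialIdeal_X_pow {m : ℕ} {i : Fin n} (hi : (i : ℕ) < m)
    {p : MvPolynomial (Fin n) K}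
    (hp : X i ^ d i * p ∈ partialIdeal (fun a => X a ^ d a) m i) :
    p ∈ partialIdeal (fun a => X a ^ d a) m i := by
  have hS : partialIdeal (fun a => (X a ^ d a : MvPolynomial (Fin n) K)) m i =
      Ideal.span ((fun s => monomial s (1 : K)) ''
        ((fun a => Finsupp.single a (d a)) '' {a : Fin n | (a : ℕ) < i} ∪
          (fun a => Finsupp.single a 1) '' {j : Fin n | m ≤ (j : ℕ)})) := by
    rw [partialIdeal, Set.image_union, Set.image_image, Set.image_image]
    simp only [X_pow_eq_monomial]
    rfl
  rw [hS, mem_ideal_span_monomial_image] at hp ⊢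
  intro ν hν
  obtain ⟨s, hs, hle⟩ := hp (Finsupp.single i (d i) + ν) (by
    rwa [mem_support_iff, X_pow_eq_monomial, coeff_monomial_mul, one_mul, ← mem_support_iff])
  refine ⟨s, hs, ?_⟩
  have hsi : s i = 0 := by
    rcases hs with ⟨a, ha, rfl⟩ | ⟨a, ha, rfl⟩
    · exact Finsupp.single_eq_of_ne fun h => by subst h; exact (lt_irrefl (i : ℕ)) ha
    · exact Finsupp.single_eq_of_ne fun h => by subst h; exact absurd hi (not_lt.2 ha)
  intro a
  by_cases h : a = i
  · rw [h, hsi]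
    exact Nat.zero_le _
  · simpa [Finsupp.single_eq_of_ne h] using hle a

variable {F : Type*} [Field F] [Algebra F K] {f : Fin n → MvPolynomial (Fin n) K}

/-- Generic forms have the Hilbert function of a complete intersection. -/
theorem IsGenericSeq.hilbertFun_eq_X_pow (hf : IsGenericSeq F d f) {m : ℕ} {i : ℕ} (hi : i ≤ m)
    (hm : m ≤ n) (t : ℕ) :
    hilbertFun (partialIdeal f m i) t =
      hilbertFun (K := K) (partialIdeal (fun a => X a ^ d a) m i) t := by
  have hX : ∀ a : Fin n, (X a ^ d a : MvPolynomial (Fin n) K).IsHomogeneous (d a) :=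
    fun a => isHomogeneous_X_pow (R := K) a (d a)
  induction i generalizing t with
  | zero => rw [partialIdeal_zero_right]
  | succ k ih =>
    obtain ⟨a, rfl⟩ : ∃ a : Fin n, (a : ℕ) = k := ⟨⟨k, by omega⟩, rfl⟩
    replace ih := ih (Nat.le_of_succ_le hi)
    refine le_antisymm ?_ (hf.hilbertFun_le hX m (a + 1) t)
    have hJ := isHomogIdeal_partialIdeal hf.1 m a
    have hJ' := isHomogIdeal_partialIdeal hX m a
    rw [partialIdeal_succ_right, partialIdeal_succ_right]
    rcases lt_or_ge t (d a) with h | h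
    · rw [hJ.hilbertFun_sup_of_lt (hf.1 a) h, hJ'.hilbertFun_sup_of_lt (hX a) h, ih]
    · obtain ⟨s, rfl⟩ := Nat.exists_eq_add_of_le' h
      have h1 := hJ.hilbertFun_sup_add (hf.1 a) s
      have h2 := hJ'.hilbertFun_sup_add (hX a) s
      have h3 := hilbertFun_le_colonFun (partialIdeal f m a) (f a) s
      have h4 := colonFun_eq_hilbertFun_iff.2 fun (p : MvPolynomial (Fin n) K) (_ : p.IsHomogeneous s) =>
        mem_of_X_pow_mul_mem_partialIdeal_X_pow (d := d) (p := p) hi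
      rw [ih] at h1 h3
      omega

theorem X_pow_eq_towerForm (a : Fin n) :
    (X a ^ d a : MvPolynomial (Fin n) K) =
      towerForm d (fun a e => if e = d a then 1 else 0) a := by
  rw [towerForm, Finset.sum_eq_single (d a)]
  · simp
  · intro e _ he
    simp [he]
  · simp

theorem codimFun_partialIdeal_towerForm_congr {γ' : Fin n → ℕ → K} (hγ : ∀ a, γ a (d a) = 1)
    (hγ' : ∀ a, γ' a (d a) = 1) {m : ℕ} (hm : m ≤ n) (t : ℕ) :
    codimFun (partialIdeal (towerForm d γ) m m) t =
      codimFun (partialIdeal (towerForm d γ') m m) t := by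
  induction m generalizing t with
  | zero => rw [partialIdeal_zero_right]
  | succ k ih =>
    obtain ⟨m, rfl⟩ : ∃ m : Fin n, (m : ℕ) = k := ⟨⟨k, hm⟩, rfl⟩
    rw [codimFun_partialIdeal_towerForm_succ (hγ m), codimFun_partialIdeal_towerForm_succ (hγ' m)]
    simp only [ih m.2.le]

theorem IsGenericSeq.hilbertFun_eq_towerForm (hf : IsGenericSeq F d f)
    (hγ : ∀ a, γ a (d a) = 1) {m : ℕ} (hm : m ≤ n) (t : ℕ) :
    hilbertFun (partialIdeal f m m) t = hilbertFun (partialIdeal (towerForm d γ) m m) t := by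
  rw [hf.hilbertFun_eq_X_pow le_rfl hm, funext (X_pow_eq_towerForm (K := K) (d := d))]
  have h := codimFun_partialIdeal_towerForm_congr (K := K) (d := d)
    (γ' := fun a e => if e = d a then 1 else 0) hγ (fun a => if_pos rfl) hm t
  have h1 := codimFun_add_hilbertFun (partialIdeal (towerForm d γ) m m) t
  have h2 := codimFun_add_hilbertFun
    (partialIdeal (towerForm (K := K) d fun a e => if e = d a then 1 else 0) m m) t
  omega

theorem exists_towerForm_coeff [Infinite K] (hd : ∀ a, 1 ≤ d a) :
    ∃ γ : Fin n → ℕ → K, (∀ a, γ a (d a) = 1) ∧ (∀ a e, d a < e → γ a e = 0) ∧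
      ∀ a : Fin n, BandNonsingular (γ a) (d a) (socleDeg d a + d a) := by
  choose γ h using fun a : Fin n => exists_bandNonsingular K (d a) (socleDeg d a + d a)
    ((hd a).trans (Nat.le_add_left _ _))
  exact ⟨γ, fun a => (h a).1, fun a => (h a).2.1, fun a => (h a).2.2⟩

theorem IsGenericSeq.mem_partialIdeal_self [Infinite K] (hf : IsGenericSeq F d f)
    (hd : ∀ a, 1 ≤ d a) {m : ℕ} (hm : m ≤ n) {t : ℕ} (ht : socleDeg d m < t)
    {p : MvPolynomial (Fin n) K} (hp : p.IsHomogeneous t) : p ∈ partialIdeal f m m := by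
  obtain ⟨γ, hγ, -, -⟩ := exists_towerForm_coeff (K := K) hd
  have h := (codimFun_partialIdeal_towerForm_symm hd hγ m hm).2 t ht
  have h1 := codimFun_add_hilbertFun (partialIdeal (towerForm d γ) m m) t
  have h2 := hf.hilbertFun_eq_towerForm hγ hm t
  exact hilbertFun_top_iff.1 (by omega) p hp

/-- Generic complete intersections: the last variable acts surjectively in high degrees. -/
theorem IsGenericSeq.mem_partialIdeal_succ [Infinite K] (hf : IsGenericSeq F d f)
    (hd : ∀ a, 1 ≤ d a) (m : Fin n) {t : ℕ} (ht : socleDeg d (m + 1) ≤ 2 * t + 1)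
    {p : MvPolynomial (Fin n) K} (hp : p.IsHomogeneous (t + 1)) :
    p ∈ partialIdeal f m (m + 1) := by
  obtain ⟨γ, hγ, hγ0, hband⟩ := exists_towerForm_coeff (K := K) hd
  have h1 := hilbertFun_top_iff.2 fun p (hp : p.IsHomogeneous (t + 1)) =>
    mem_partialIdeal_towerForm hd hγ hγ0 hband m ht hp
  have h2 := hf.hilbertFun_le (isHomogeneous_towerForm d γ) m (m + 1) (t + 1)
  have h3 := hilbertFun_mono (le_top (a := partialIdeal f m (m + 1))) (t + 1)
  exact hilbertFun_top_iff.1 (by omega) p hp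

/-- Generic complete intersections: the last variable acts injectively in low degrees. -/
theorem IsGenericSeq.mem_of_X_mul_mem [Infinite K] (hf : IsGenericSeq F d f)
    (hd : ∀ a, 1 ≤ d a) (m : Fin n) {t : ℕ} (ht : 2 * t < socleDeg d (m + 1)) :
    ∀ p : MvPolynomial (Fin n) K, p.IsHomogeneous t →
      X m * p ∈ partialIdeal f (m + 1) (m + 1) → p ∈ partialIdeal f (m + 1) (m + 1) := by
  obtain ⟨γ, hγ, hγ0, hband⟩ := exists_towerForm_coeff (K := K) hd
  have hcol := colonFun_eq_hilbertFun_iff.2 fun p (hp : p.IsHomogeneous t) =>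
    mem_of_X_mul_mem_partialIdeal_towerForm_succ hd hγ0 hband m ht hp
  have h1 := (isHomogIdeal_partialIdeal hf.1 (m + 1) (m + 1)).hilbertFun_sup_add
    (isHomogeneous_X K m) t
  have h2 := (isHomogIdeal_partialIdeal (isHomogeneous_towerForm d γ) (m + 1)
    (m + 1)).hilbertFun_sup_add (isHomogeneous_X K m) t
  rw [← partialIdeal_succ_left] at h1 h2
  have h3 := hf.hilbertFun_le (isHomogeneous_towerForm d γ) m (m + 1) (t + 1)
  have h4 := hf.hilbertFun_eq_towerForm hγ m.2 t
  have h5 := hf.hilbertFun_eq_towerForm hγ m.2 (t + 1)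
  have h6 := hilbertFun_le_colonFun (partialIdeal f (m + 1) (m + 1)) (X m) t
  simp only [Nat.succ_eq_add_one] at h4 h5
  exact colonFun_eq_hilbertFun_iff.1 (by omega)

/-- A generic form lies in the ideal of its predecessors only if all forms of its degree do. -/
theorem IsGenericSeq.notMem_partialIdeal (hf : IsGenericSeq F d f) (m : ℕ) (r : Fin n)
    {g : MvPolynomial (Fin n) K} (hg : g.IsHomogeneous (d r)) (hgJ : g ∉ partialIdeal f m r) :
    f r ∉ partialIdeal f m r := by
  classical
  intro hfr
  have hJ : partialIdeal (Function.update f r g) m r = partialIdeal f m r := by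
    rw [partialIdeal, partialIdeal]
    congr 2
    refine Set.image_congr fun a ha => Function.update_of_ne (fun h => ?_) _ _
    subst h
    exact lt_irrefl (a : ℕ) ha
  have hle := hf.hilbertFun_le (f' := Function.update f r g) (fun i => by
    by_cases h : i = r
    · subst h; rwa [Function.update_self]
    · rw [Function.update_of_ne h]; exact hf.1 i) m (r + 1) (d r)
  rw [partialIdeal_succ_right, partialIdeal_succ_right, hJ, Function.update_self,
    sup_eq_left.2 ((Ideal.span_singleton_le_iff_mem _).2 hfr)] at hle
  have := finite_degPiece (partialIdeal f m r ⊔ Ideal.span {g}) (d r)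
  have heq := Submodule.eq_of_le_of_finrank_le
    (degPiece_mono (le_sup_left : partialIdeal f m r ≤ _ ⊔ Ideal.span {g}) (d r)) hle
  have hmem : g ∈ degPiece (partialIdeal f m r ⊔ Ideal.span {g}) (d r) :=
    ⟨Ideal.mem_sup_right (Ideal.subset_span rfl), hg⟩
  rw [← heq] at hmem
  exact hgJ hmem.1

/-- The maximal rank property of the `m`-th variable modulo the first `r` forms. -/
theorem IsGenericSeq.injective_or_surjective [Infinite K] (hf : IsGenericSeq F d f)
    (hd : ∀ a, 1 ≤ d a)
    (hσ : ∀ r : Fin n, min (socleDeg d ((r : ℕ) - 1)) (socleDeg d r / 2) ≤ d r)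
    (m : Fin n) (t : ℕ) {r : ℕ} (hmr : (m : ℕ) + 1 ≤ r) (hr : r ≤ n) :
    (∀ p : MvPolynomial (Fin n) K, p.IsHomogeneous t →
      X m * p ∈ partialIdeal f (m + 1) r → p ∈ partialIdeal f (m + 1) r) ∨
    ∀ p : MvPolynomial (Fin n) K, p.IsHomogeneous (t + 1) → p ∈ partialIdeal f m r := by
  induction r, hmr using Nat.le_induction with
  | base =>
    rcases lt_or_ge (2 * t) (socleDeg d (m + 1)) with h | h
    · exact Or.inl (hf.mem_of_X_mul_mem hd m h)
    · exact Or.inr fun p => hf.mem_partialIdeal_succ hd m (by omega)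
  | succ r hmr ih =>
    obtain ⟨a, rfl⟩ : ∃ a : Fin n, (a : ℕ) = r := ⟨⟨r, hr⟩, rfl⟩
    have hJ := isHomogIdeal_partialIdeal hf.1 (m + 1) a
    have hX : ∀ {p : MvPolynomial (Fin n) K}, p.IsHomogeneous t →
        (X m * p).IsHomogeneous (t + 1) := fun hp =>
      add_comm t 1 ▸ (isHomogeneous_X K m).mul hp
    simp only [partialIdeal_succ_right]
    rcases ih a.2.le with ih | ih
    swap
    · exact Or.inr fun p hp => Ideal.mem_sup_left (ih p hp)
    rcases lt_trichotomy (t + 1) (d a) with h | h | h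
    · exact Or.inl fun p hp hmem => Ideal.mem_sup_left
        (ih p hp (hJ.mem_of_mem_sup_of_lt (hf.1 a) (hX hp) hmem h))
    · by_cases hall : ∀ p : MvPolynomial (Fin n) K, p.IsHomogeneous (t + 1) →
          p ∈ partialIdeal f m a
      · exact Or.inr fun p hp => Ideal.mem_sup_left (hall p hp)
      push Not at hall
      obtain ⟨g, hg, hgJ⟩ := hall
      have hfa := hf.notMem_partialIdeal m a (h ▸ hg) hgJ
      refine Or.inl fun p hp hmem => Ideal.mem_sup_left (ih p hp ?_)
      obtain ⟨q, hq, hqJ⟩ := hJ.exists_sub_mul_mem (s := 0) (hf.1 a)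
        (by rw [zero_add, ← h]; exact hX hp) hmem
      rw [totalDegree_eq_zero_iff_eq_C.1 ((totalDegree_zero_iff_isHomogeneous _).2 hq)] at hqJ
      by_cases hc : coeff 0 q = 0
      · simpa [hc] using hqJ
      refine absurd ?_ hfa
      have hXp : X m * p ∈ partialIdeal f m a :=
        Ideal.mul_mem_right _ _ (X_mem_partialIdeal le_rfl)
      have hfq := Ideal.sub_mem _ hXp (partialIdeal_mono (Nat.le_succ m) le_rfl hqJ)
      rw [sub_sub_cancel] at hfq
      exact (Ideal.mul_unit_mem_iff_mem _ ((isUnit_iff_ne_zero.2 hc).map C)).1 hfq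
    · refine Or.inr fun p hp => Ideal.mem_sup_left ?_
      obtain ⟨b, hb⟩ : ∃ b : Fin n, (b : ℕ) + 1 = a :=
        ⟨⟨(a : ℕ) - 1, by omega⟩, by simp only; omega⟩
      have hσa := hσ a
      rw [← hb, Nat.add_sub_cancel] at hσa
      rw [← hb]
      rcases min_le_iff.1 hσa with h' | h'
      · exact partialIdeal_mono (by omega) (Nat.le_succ _)
          (hf.mem_partialIdeal_self hd b.2.le (by omega) hp)
      · exact partialIdeal_mono (by omega) le_rfl
          (hf.mem_partialIdeal_succ hd b (by omega) hp)

theorem sum_sub_eq_socleDeg (hd : ∀ a, 1 ≤ d a) {i : ℕ} (hi : i ≤ n) :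
    (∑ j ∈ Finset.univ.filter (fun j : Fin n => (j : ℕ) < i), d j) - i = socleDeg d i := by
  have hcard : (Finset.univ.filter fun j : Fin n => (j : ℕ) < i).card = i := by
    rw [Fin.card_filter_val_lt, min_eq_right hi]
  have : ∑ j ∈ Finset.univ.filter (fun j : Fin n => (j : ℕ) < i), d j =
      ∑ j ∈ Finset.univ.filter (fun j : Fin n => (j : ℕ) < i), (d j - 1 + 1) :=
    Finset.sum_congr rfl fun j _ => (Nat.sub_add_cancel (hd j)).symm
  rw [this, Finset.sum_add_distrib, Finset.sum_const, hcard, smul_eq_mul, mul_one,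
    Nat.add_sub_cancel, socleDeg]

theorem partialIdeal_eq_sup {k : ℕ} (hn : 0 < n) (hk : k ≤ n) :
    partialIdeal f (n - k) n = Ideal.span (Set.range f) ⊔ Ideal.span ((fun j : ℕ =>
      (X (⟨n - 1 - j, by omega⟩ : Fin n) : MvPolynomial (Fin n) K)) '' { j | j < k }) := by
  rw [partialIdeal, Ideal.span_union]
  congr 2
  · simp
  · ext p
    constructor
    · rintro ⟨j, hj, rfl⟩
      refine ⟨n - 1 - j, ?_, congrArg X (Fin.ext ?_)⟩
      · simp only [Set.mem_ofPred_eq] at hj ⊢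
        omega
      · simp only
        omega
    · rintro ⟨j, hj, rfl⟩
      refine ⟨_, ?_, rfl⟩
      simp only [Set.mem_ofPred_eq] at hj ⊢
      omega

end lefschetz

/-- for a generic ideal `I` of type `(n; d_1,…,d_n)` with `d_1 ≤ ⋯ ≤ d_n` and
`d_i ≥ σ_{i−1}` for all `4 ≤ i ≤ n`, the sequence `x_n, x_{n−1}, …, x_1` is a semi-regular
sequence on `K[x_1,…,x_n]/I`. -/
theorem stmt17 {F K : Type*} [Field F] [Field K] [Algebra F K] [Infinite K]
    {n : ℕ} (hn : 0 < n) (d : Fin n → ℕ) (hd : ∀ i, 1 ≤ d i) (hmono : Monotone d)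
    (f : Fin n → MvPolynomial (Fin n) K) (hf : IsGenericSeq F d f)
    (I : Ideal (MvPolynomial (Fin n) K)) (hI : I = Ideal.span (Set.range f))
    (δf σf : ℕ → ℕ)
    (hδf : ∀ i : ℕ, δf i = (∑ j ∈ Finset.univ.filter (fun j : Fin n => (j : ℕ) < i), d j) - i)
    (hσf : ∀ i : ℕ, σf i = min (δf (i - 1)) (δf i / 2))
    (hcond : ∀ i : ℕ, 4 ≤ i → ∀ hi : i ≤ n, σf (i - 1) ≤ d ⟨i - 1, by omega⟩) :
    ∀ k : ℕ, k < n →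
      SemiRegularOn
        (I ⊔ Ideal.span ((fun j : ℕ =>
          (X (⟨n - 1 - j, by omega⟩ : Fin n) : MvPolynomial (Fin n) K)) '' { j | j < k }))
        (X (⟨n - 1 - k, by omega⟩ : Fin n)) 1 := by
  intro k hk t
  have hσ : ∀ r : Fin n, min (socleDeg d ((r : ℕ) - 1)) (socleDeg d r / 2) ≤ d r := by
    intro r
    rcases lt_or_ge (r : ℕ) 3 with h | h
    · refine min_le_of_left_le ?_
      rcases lt_or_ge (r : ℕ) 2 with h' | h'
      · rw [show (r : ℕ) - 1 = 0 by omega, socleDeg_zero]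
        exact Nat.zero_le _
      · have h1 := socleDeg_succ d ⟨0, hn⟩
        have h2 : d ⟨0, hn⟩ ≤ d r := hmono (Nat.zero_le _)
        simp only [socleDeg_zero, zero_add] at h1
        rw [show (r : ℕ) - 1 = 1 by omega, h1]
        omega
    · have hr : σf r ≤ d r := hcond (r + 1) (by omega) r.2
      rw [hσf, hδf, hδf, sum_sub_eq_socleDeg hd (by omega),
        sum_sub_eq_socleDeg hd (by omega)] at hr
      exact hr
  rw [hI, ← partialIdeal_eq_sup hn hk.le]
  obtain ⟨m, hm⟩ : ∃ m : Fin n, m = ⟨n - 1 - k, by omega⟩ := ⟨_, rfl⟩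
  have hmk : n - k = (m : ℕ) + 1 := by
    rw [hm]
    simp only
    omega
  rw [← hm, hmk]
  refine (hf.injective_or_surjective hd hσ m t m.2 le_rfl).imp_right fun h q hq => ?_
  have hqJ := h q hq
  rw [partialIdeal_succ_left] at hqJ
  exact (isHomogIdeal_partialIdeal hf.1 (m + 1) n).exists_sub_mul_mem (isHomogeneous_X K m) hq hqJ
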